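/- arXiv:1401.3702 — 3 statements merged into one kernel-verified Lean document; each statement's English description precedes it below -/
import Mathlib

section
/- Let p be a prime, q = p^n, and let ℓ ≥ 2 and r ≥ 1 be integers such that ℓ/u is even, where u = gcd(ℓ, r). Let a, b, c ∈ F_{q^ℓ} with a ≠ 0 and set f(x) = a^{q^r}·x^{q^{2r}} + a·x. Suppose the map x ↦ f(x) is not a bijection of F_{q^ℓ}, but that the equation f(x) = −b^{q^r} has a solution x₀ ∈ F_{q^ℓ}; set c₁ = a·x₀^{q^r+1} − c. Then N_{ℓ,r}(a,b,c) = q^ℓ + (−1)^{ℓ/(2u)+1}·q^{ℓ/2+u}·(q−1) if T(c₁) = 0, and N_{ℓ,r}(a,b,c) = q^ℓ + (−1)^{ℓ/(2u)}·q^{ℓ/2+u} if T(c₁) ≠ 0. -/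
section
open Finset

variable {F : Type*} [Field F] {q ℓ u r m j : ℕ} {s : F}

/-- The sum of the first `ℓ` iterates of the `q`-power map at `z`: the trace of `z` from the field
with `q ^ ℓ` elements to the one with `q` elements. -/
def frobTrace (q ℓ : ℕ) (z : F) : F := ∑ i ∈ range ℓ, z ^ q ^ i

lemma add_pow_pow_of_add_pow (h : ∀ x y : F, (x + y) ^ q = x ^ q + y ^ q) (k : ℕ) (x y : F) :
    (x + y) ^ q ^ k = x ^ q ^ k + y ^ q ^ k := by
  induction k with
  | zero => simp
  | succ k ih => rw [pow_succ, pow_mul, ih, h, ← pow_mul, ← pow_mul]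

lemma neg_pow_pow_of_add_pow (h : ∀ x y : F, (x + y) ^ q = x ^ q + y ^ q) (k : ℕ) (x : F) :
    (-x) ^ q ^ k = -x ^ q ^ k :=
  map_neg (AddMonoidHom.mk' (fun x : F => x ^ q ^ k) (add_pow_pow_of_add_pow h k)) x

lemma sub_pow_pow_of_add_pow (h : ∀ x y : F, (x + y) ^ q = x ^ q + y ^ q) (k : ℕ) (x y : F) :
    (x - y) ^ q ^ k = x ^ q ^ k - y ^ q ^ k :=
  map_sub (AddMonoidHom.mk' (fun x : F => x ^ q ^ k) (add_pow_pow_of_add_pow h k)) x y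

lemma frobTrace_add (h : ∀ x y : F, (x + y) ^ q = x ^ q + y ^ q) (x y : F) :
    frobTrace q ℓ (x + y) = frobTrace q ℓ x + frobTrace q ℓ y := by
  simp_rw [frobTrace, add_pow_pow_of_add_pow h, sum_add_distrib]

/-- `frobTrace` as an additive homomorphism. -/
def frobTraceHom (ℓ : ℕ) (h : ∀ x y : F, (x + y) ^ q = x ^ q + y ^ q) : F →+ F :=
  AddMonoidHom.mk' (frobTrace q ℓ) (frobTrace_add h)

lemma frobTrace_zero (h : ∀ x y : F, (x + y) ^ q = x ^ q + y ^ q) :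
    frobTrace q ℓ (0 : F) = 0 :=
  map_zero (frobTraceHom ℓ h)

lemma frobTrace_neg (h : ∀ x y : F, (x + y) ^ q = x ^ q + y ^ q) (x : F) :
    frobTrace q ℓ (-x) = -frobTrace q ℓ x :=
  map_neg (frobTraceHom ℓ h) x

lemma frobTrace_sub (h : ∀ x y : F, (x + y) ^ q = x ^ q + y ^ q) (x y : F) :
    frobTrace q ℓ (x - y) = frobTrace q ℓ x - frobTrace q ℓ y :=
  map_sub (frobTraceHom ℓ h) x y

lemma frobTrace_mul_of_pow_eq {t : F} (ht : t ^ q = t) (x : F) :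
    frobTrace q ℓ (t * x) = t * frobTrace q ℓ x := by
  have hk (k : ℕ) : t ^ q ^ k = t := by
    induction k with
    | zero => simp
    | succ k ih => rw [pow_succ, pow_mul, ih, ht]
  simp_rw [frobTrace, mul_pow, hk, mul_sum]

lemma pow_pow_mul_eq_self {k : ℕ} {x : F} (hx : x ^ q ^ k = x) (j : ℕ) : x ^ q ^ (k * j) = x := by
  induction j with
  | zero => simp
  | succ j ih => rw [Nat.mul_succ, pow_add, pow_mul, ih, hx]

lemma pow_pow_odd_mul (hr : r = u * (2 * j + 1)) {x : F} (hx : x ^ q ^ (2 * u) = x) :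
    x ^ q ^ r = x ^ q ^ u := by
  rw [show r = 2 * u * j + u by rw [hr]; ring, pow_add, pow_mul, pow_pow_mul_eq_self hx]

lemma frobTrace_eq_zero_of_pow_eq_neg (h : ∀ x y : F, (x + y) ^ q = x ^ q + y ^ q) {y : F}
    (hy : y ^ q ^ u = -y) (m : ℕ) : frobTrace q (u * (2 * m)) y = 0 := by
  have key (n : ℕ) : frobTrace q (u + n) y = frobTrace q u y - frobTrace q n y := by
    simp_rw [frobTrace, sum_range_add, pow_add, pow_mul, hy, neg_pow_pow_of_add_pow h,
      sum_neg_distrib, sub_eq_add_neg]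
  induction m with
  | zero => simp [frobTrace]
  | succ m ih =>
    rw [show u * (2 * (m + 1)) = u + (u + u * (2 * m)) by ring, key, key, ih]
    ring

variable [Fintype F]

lemma pow_pow_bijective_of_add_pow (h : ∀ x y : F, (x + y) ^ q = x ^ q + y ^ q) (k : ℕ) :
    Function.Bijective (fun x : F => x ^ q ^ k) := by
  refine Finite.injective_iff_bijective.mp fun x y hxy => ?_
  have h0 : (x - y) ^ q ^ k = 0 := by
    rw [sub_pow_pow_of_add_pow h]
    exact sub_eq_zero.mpr hxy
  exact sub_eq_zero.mp (eq_zero_of_pow_eq_zero h0)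

lemma frobTrace_pow (hF : Fintype.card F = q ^ ℓ) (x : F) :
    frobTrace q ℓ (x ^ q) = frobTrace q ℓ x := by
  have hx : x ^ q ^ ℓ = x := hF ▸ FiniteField.pow_card x
  have h1 := sum_range_succ (fun i => x ^ q ^ i) ℓ
  rw [sum_range_succ'] at h1
  simp only [hx, pow_zero, pow_one] at h1
  simp_rw [frobTrace, ← pow_mul, ← pow_succ']
  exact add_right_cancel h1

lemma frobTrace_pow_pow (hF : Fintype.card F = q ^ ℓ) (k : ℕ) (x : F) :
    frobTrace q ℓ (x ^ q ^ k) = frobTrace q ℓ x := by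
  induction k with
  | zero => simp
  | succ k ih => rw [pow_succ, pow_mul, frobTrace_pow hF, ih]

lemma frobTrace_pow_eq_self (h : ∀ x y : F, (x + y) ^ q = x ^ q + y ^ q)
    (hF : Fintype.card F = q ^ ℓ) (x : F) : frobTrace q ℓ x ^ q = frobTrace q ℓ x := by
  have hs : frobTrace q ℓ x ^ q = frobTrace q ℓ (x ^ q) := by
    have := map_sum (AddMonoidHom.mk' (fun x : F => x ^ q) h) (fun i => x ^ q ^ i) (range ℓ)
    simp only [AddMonoidHom.mk'_apply] at this
    simp_rw [frobTrace, this, ← pow_mul, mul_comm]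
  rw [hs, frobTrace_pow hF]

lemma card_filter_pow_eq_one {G : Type*} [CommGroup G] [Fintype G] [DecidableEq G] [IsCyclic G]
    (d : ℕ) : #{x : G | x ^ d = 1} = (Fintype.card G).gcd d := by
  rw [← Nat.card_eq_fintype_card, ← IsCyclic.card_powMonoidHom_ker, ← Fintype.card_subtype,
    ← Nat.card_eq_fintype_card]
  rfl

lemma pow_pow_gcd_eq_self (hF : Fintype.card F = q ^ ℓ) {k : ℕ} {x : F} (hx : x ^ q ^ k = x) :
    x ^ q ^ k.gcd ℓ = x := by
  have h1 : Function.IsPeriodicPt (fun y : F => y ^ q) k x := by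
    rw [Function.IsPeriodicPt, Function.IsFixedPt, pow_iterate]
    exact hx
  have h2 : Function.IsPeriodicPt (fun y : F => y ^ q) ℓ x := by
    rw [Function.IsPeriodicPt, Function.IsFixedPt, pow_iterate, ← hF]
    exact FiniteField.pow_card x
  have h3 := h1.gcd h2
  rwa [Function.IsPeriodicPt, Function.IsFixedPt, pow_iterate] at h3

lemma pow_pow_eq_neg (h : ∀ x y : F, (x + y) ^ q = x ^ q + y ^ q) (hF : Fintype.card F = q ^ ℓ)
    (hr : r = u * (2 * j + 1)) (hg : (2 * r).gcd ℓ = 2 * u) {y : F} (hy : y ^ q ^ r = -y) :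
    y ^ q ^ u = -y := by
  have h2 : y ^ q ^ (2 * r) = y := by
    rw [two_mul, pow_add, pow_mul, hy, neg_pow_pow_of_add_pow h, hy, neg_neg]
  rw [← pow_pow_odd_mul hr (hg ▸ pow_pow_gcd_eq_self hF h2), hy]

lemma frobTrace_form_add_sub (h : ∀ x y : F, (x + y) ^ q = x ^ q + y ^ q)
    (hF : Fintype.card F = q ^ ℓ) (hs : s ^ q ^ r = -s) (x w : F) :
    frobTrace q ℓ (s * (x + w) ^ (q ^ r + 1)) - frobTrace q ℓ (s * x ^ (q ^ r + 1)) =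
      frobTrace q ℓ (s * (w - w ^ q ^ (2 * r)) * x ^ q ^ r) +
        frobTrace q ℓ (s * w ^ (q ^ r + 1)) := by
  have h1 : frobTrace q ℓ (s * x * w ^ q ^ r) =
      frobTrace q ℓ (-(s * x ^ q ^ r * w ^ q ^ (2 * r))) := by
    rw [← frobTrace_pow_pow hF r (s * x * w ^ q ^ r), mul_pow, mul_pow, hs, ← pow_mul w, ← pow_add,
      two_mul, neg_mul, neg_mul]
  have h2 : s * (x + w) ^ (q ^ r + 1) =
      s * x ^ (q ^ r + 1) + s * x * w ^ q ^ r + s * w * x ^ q ^ r + s * w ^ (q ^ r + 1) := by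
    rw [pow_succ, add_pow_pow_of_add_pow h]
    ring
  have h3 : s * (w - w ^ q ^ (2 * r)) * x ^ q ^ r =
      -(s * x ^ q ^ r * w ^ q ^ (2 * r)) + s * w * x ^ q ^ r := by ring
  rw [h2, h3]
  simp only [frobTrace_add h, h1]
  ring

lemma exists_pow_eq_of_pow_eq_one {G : Type*} [CommGroup G] [Fintype G] [IsCyclic G] {k d : ℕ}
    (hkd : k * d ∣ Fintype.card G) (hk : 0 < k) {x : G} (hx : x ^ k = 1) : ∃ y, y ^ d = x := by
  obtain ⟨g, hg⟩ := IsCyclic.exists_generator (α := G)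
  obtain ⟨i, rfl⟩ : ∃ i : ℕ, g ^ i = x := by
    exact Submonoid.mem_powers_iff _ _ |>.mp (mem_powers_iff_mem_zpowers.mpr (hg x))
  rw [← pow_mul] at hx
  have h1 : k * d ∣ i * k := by
    refine hkd.trans ?_
    rw [← Nat.card_eq_fintype_card, ← orderOf_eq_card_of_forall_mem_zpowers hg]
    exact orderOf_dvd_of_pow_eq_one hx
  rw [mul_comm i k] at h1
  obtain ⟨e, rfl⟩ := Nat.dvd_of_mul_dvd_mul_left hk h1
  exact ⟨g ^ e, by rw [← pow_mul, mul_comm]⟩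

lemma pow_sub_one_mul_pow_add_one (q u : ℕ) : (q ^ u - 1) * (q ^ u + 1) = q ^ (2 * u) - 1 := by
  rw [mul_comm, ← Nat.sq_sub_sq, one_pow, ← pow_mul, mul_comm]

variable [DecidableEq F]

lemma card_filter_pow_pow_eq_self (hq : 2 ≤ q) (hF : Fintype.card F = q ^ ℓ) (k : ℕ) :
    #{x : F | x ^ q ^ k = x} = q ^ k.gcd ℓ := by
  have h1 : #{x : Fˣ | x ^ (q ^ k - 1) = 1} = q ^ k.gcd ℓ - 1 := by
    rw [card_filter_pow_eq_one, Fintype.card_units, hF, Nat.pow_sub_one_gcd_pow_sub_one, Nat.gcd_comm]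
  have hk : 0 < q ^ k := by positivity
  have h2 : ({x : F | x ^ q ^ k = x} : Finset F) =
      insert 0 (({x : Fˣ | x ^ (q ^ k - 1) = 1} : Finset Fˣ).image Units.val) := by
    ext x
    obtain ⟨m, hm⟩ := Nat.exists_eq_add_of_lt hk
    rw [zero_add] at hm
    simp only [mem_filter, mem_univ, true_and, mem_insert, mem_image, hm, Nat.add_sub_cancel]
    constructor
    · intro hx
      refine or_iff_not_imp_left.mpr fun h0 => ⟨Units.mk0 x h0, ?_, rfl⟩
      ext
      push_cast
      exact mul_right_cancel₀ h0 (by rw [Units.val_mk0, ← pow_succ, hx, one_mul])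
    · rintro (rfl | ⟨y, hy, rfl⟩)
      · simp
      · rw [pow_succ, ← Units.val_pow_eq_pow_val, hy, Units.val_one, one_mul]
  rw [h2, card_insert_of_notMem (by simp), card_image_of_injective _ Units.val_injective, h1]
  exact Nat.sub_add_cancel (Nat.one_le_pow _ _ (by omega))

lemma card_filter_pow_eq_self (hq : 2 ≤ q) (hF : Fintype.card F = q ^ ℓ) :
    #{x : F | x ^ q = x} = q := by
  simpa using card_filter_pow_pow_eq_self hq hF 1

lemma AddMonoidHom.card_filter_eq {A B : Type*} [AddGroup A] [AddGroup B] [Fintype A]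
    [DecidableEq B] (f : A →+ B) {t : B} (ht : ∃ x, f x = t) :
    #{x | f x = t} = #{x | f x = 0} :=
  AddMonoidHom.card_fiber_eq_of_mem_range f ht ⟨0, map_zero f⟩

lemma AddMonoidHom.card_filter_mul_card_image {A B : Type*} [AddGroup A] [AddGroup B] [Fintype A]
    [DecidableEq B] (f : A →+ B) :
    #{x | f x = 0} * #(univ.image f) = Fintype.card A := by
  rw [← card_univ, card_eq_sum_card_image f univ, sum_const_nat (m := #{x | f x = 0}), mul_comm]
  intro t ht
  obtain ⟨x, -, hx⟩ := mem_image.mp ht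
  exact f.card_filter_eq ⟨x, hx⟩

lemma card_filter_frobTrace_eq_zero_le (hq : 2 ≤ q) (hℓ : 1 ≤ ℓ) :
    #{x : F | frobTrace q ℓ x = 0} ≤ q ^ (ℓ - 1) := by
  open Polynomial in
  set P : F[X] := ∑ i ∈ range ℓ, X ^ q ^ i with hP
  have hc : P.coeff (q ^ (ℓ - 1)) = 1 := by
    rw [hP, finsetSum_coeff, sum_eq_single (ℓ - 1)]
    · simp
    · intro i _ hi
      rw [coeff_X_pow, if_neg fun h => hi (Nat.pow_right_injective hq h).symm]
    · intro hn
      exact absurd (mem_range.mpr (by omega)) hn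
  have h0 : P ≠ 0 := by
    intro h0
    simp [h0] at hc
  have hd : P.natDegree ≤ q ^ (ℓ - 1) := by
    refine natDegree_sum_le_of_forall_le _ _ fun i hi => ?_
    rw [natDegree_X_pow]
    exact Nat.pow_le_pow_right (by omega) (by have := mem_range.mp hi; omega)
  refine le_trans ?_ ((P.card_roots').trans hd)
  refine (card_le_card fun x hx => ?_).trans (Multiset.toFinset_card_le P.roots)
  rw [Multiset.mem_toFinset, mem_roots h0, IsRoot, hP, eval_finsetSum]
  simpa [eval_finsetSum, frobTrace] using (mem_filter.mp hx).2

lemma frobTrace_card (h : ∀ x y : F, (x + y) ^ q = x ^ q + y ^ q) (hq : 2 ≤ q) (hℓ : 1 ≤ ℓ)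
    (hF : Fintype.card F = q ^ ℓ) :
    #{x : F | frobTrace q ℓ x = 0} = q ^ (ℓ - 1) ∧
      univ.image (frobTrace q ℓ) = ({x : F | x ^ q = x} : Finset F) := by
  have h1 : #{x : F | frobTrace q ℓ x = 0} * #(univ.image (frobTrace (F := F) q ℓ)) = q ^ ℓ :=
    hF ▸ (frobTraceHom (F := F) ℓ h).card_filter_mul_card_image
  have h2 := card_filter_frobTrace_eq_zero_le (F := F) hq hℓ
  have hsub : univ.image (frobTrace q ℓ) ⊆ ({x : F | x ^ q = x} : Finset F) := by
    intro t ht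
    obtain ⟨x, -, rfl⟩ := mem_image.mp ht
    simp [frobTrace_pow_eq_self h hF]
  have h3 := card_le_card hsub
  rw [card_filter_pow_eq_self hq hF] at h3
  have h4 : q ^ ℓ = q ^ (ℓ - 1) * q := by rw [← pow_succ, Nat.sub_add_cancel hℓ]
  have hpos : 0 < q ^ (ℓ - 1) := by positivity
  constructor
  · refine le_antisymm h2 ?_
    rw [h4] at h1
    refine Nat.le_of_mul_le_mul_right ?_ (show 0 < q by omega)
    rw [← h1]
    gcongr
  · refine eq_of_subset_of_card_le hsub ?_
    rw [card_filter_pow_eq_self hq hF]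
    refine Nat.le_of_mul_le_mul_left ?_ hpos
    rw [← h4, ← h1]
    gcongr

lemma exists_frobTrace_eq (h : ∀ x y : F, (x + y) ^ q = x ^ q + y ^ q) (hq : 2 ≤ q) (hℓ : 1 ≤ ℓ)
    (hF : Fintype.card F = q ^ ℓ) {t : F} (ht : t ^ q = t) : ∃ x : F, frobTrace q ℓ x = t := by
  have : t ∈ univ.image (frobTrace q ℓ) := by
    rw [(frobTrace_card h hq hℓ hF).2]
    simpa using ht
  simpa using this

lemma card_filter_frobTrace_eq (h : ∀ x y : F, (x + y) ^ q = x ^ q + y ^ q) (hq : 2 ≤ q)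
    (hℓ : 1 ≤ ℓ) (hF : Fintype.card F = q ^ ℓ) {t : F} (ht : t ^ q = t) :
    #{x : F | frobTrace q ℓ x = t} = q ^ (ℓ - 1) :=
  ((frobTraceHom ℓ h).card_filter_eq (exists_frobTrace_eq h hq hℓ hF ht)).trans
    (frobTrace_card h hq hℓ hF).1

/-- Additive Hilbert 90, counting form. -/
lemma card_filter_pow_sub_eq (h : ∀ x y : F, (x + y) ^ q = x ^ q + y ^ q) (hq : 2 ≤ q)
    (hℓ : 1 ≤ ℓ) (hF : Fintype.card F = q ^ ℓ) (z : F) :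
    #{y : F | y ^ q - y = z} = if frobTrace q ℓ z = 0 then q else 0 := by
  let f : F →+ F := AddMonoidHom.mk' (fun y : F => y ^ q - y) fun x y => by rw [h]; ring
  have hker : #{y : F | f y = 0} = q := by
    simp only [f, AddMonoidHom.mk'_apply, sub_eq_zero, card_filter_pow_eq_self hq hF]
  have h1 := f.card_filter_mul_card_image
  have h4 : q ^ ℓ = q * q ^ (ℓ - 1) := by rw [← pow_succ', Nat.sub_add_cancel hℓ]
  rw [hker, hF, h4] at h1
  have h2 := Nat.eq_of_mul_eq_mul_left (by omega) h1
  have hsub : univ.image f ⊆ ({z : F | frobTrace q ℓ z = 0} : Finset F) := by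
    intro t ht
    obtain ⟨y, -, rfl⟩ := mem_image.mp ht
    simp [f, frobTrace_sub h, frobTrace_pow hF]
  have heq := eq_of_subset_of_card_le hsub (by rw [h2, (frobTrace_card h hq hℓ hF).1])
  have hmem : z ∈ univ.image f ↔ frobTrace q ℓ z = 0 := by rw [heq]; simp
  split_ifs with hz
  · obtain ⟨y, -, hy⟩ := mem_image.mp (hmem.mpr hz)
    exact (f.card_filter_eq ⟨y, hy⟩).trans hker
  · rw [card_eq_zero, filter_eq_empty_iff]
    exact fun y _ hy => hz (hmem.mp (mem_image.mpr ⟨y, mem_univ _, hy⟩))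

lemma mul_dvd_card_units (hF : Fintype.card F = q ^ ℓ) (hℓ : ℓ = u * (2 * m)) :
    (q ^ u - 1) * (q ^ u + 1) ∣ Fintype.card Fˣ := by
  rw [Fintype.card_units, hF, pow_sub_one_mul_pow_add_one]
  exact Nat.pow_sub_one_dvd_pow_sub_one q ⟨m, by rw [hℓ]; ring⟩

/-- Surjectivity of the norm from the field with `q ^ (2 * u)` elements onto the one with `q ^ u`
elements, at elements fixed by the `q`-power map. -/
lemma exists_pow_add_one_eq (hq : 2 ≤ q) (hF : Fintype.card F = q ^ ℓ) (hu : 0 < u)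
    (hℓ : ℓ = u * (2 * m)) {t : F} (ht0 : t ≠ 0) (ht : t ^ q = t) :
    ∃ ζ : F, ζ ^ q ^ (2 * u) = ζ ∧ ζ ^ (q ^ u + 1) = t := by
  have htu : t ^ q ^ u = t := by
    simpa using pow_pow_mul_eq_self (q := q) (k := 1) (by simpa using ht) u
  have hqu : 1 < q ^ u := Nat.one_lt_pow hu.ne' hq
  have h1 : (Units.mk0 t ht0) ^ (q ^ u - 1) = 1 := by
    ext
    push_cast
    refine mul_right_cancel₀ ht0 ?_
    rw [Units.val_mk0, ← pow_succ, Nat.sub_add_cancel hqu.le, htu, one_mul]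
  obtain ⟨ζ, hζ⟩ := exists_pow_eq_of_pow_eq_one (mul_dvd_card_units hF hℓ) (by omega) h1
  have h2 : (ζ : F) ^ (q ^ u + 1) = t := by
    rw [← Units.val_pow_eq_pow_val, hζ, Units.val_mk0]
  refine ⟨ζ, ?_, h2⟩
  have h3 : ((ζ : F) ^ (q ^ u + 1)) ^ q ^ u = (ζ : F) ^ (q ^ u + 1) := by rw [h2, htu]
  have h4 : (ζ : F) ^ q ^ u ≠ 0 := pow_ne_zero _ ζ.ne_zero
  refine mul_right_cancel₀ h4 ?_
  rw [two_mul, pow_add, pow_mul, ← mul_pow, ← pow_succ, h3, pow_succ, mul_comm]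

lemma dvd_card_filter_pow {G : Type*} [CommGroup G] [Fintype G] [DecidableEq G] [IsCyclic G]
    {d : ℕ} (hd : d ∣ Fintype.card G) (P : G → Prop) [DecidablePred P] :
    d ∣ #{x : G | P (x ^ d)} := by
  rw [card_eq_sum_card_image (fun x => x ^ d)]
  refine dvd_sum fun b hb => dvd_of_eq ?_
  obtain ⟨y, hy, rfl⟩ := mem_image.mp hb
  have h1 : filter (fun x => x ^ d = y ^ d) ({x : G | P (x ^ d)} : Finset G) =
      ({x : G | x ^ d = y ^ d} : Finset G) := by
    ext x
    simp only [mem_filter, mem_univ, true_and] at hy ⊢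
    exact ⟨And.right, fun hx => ⟨hx ▸ hy, hx⟩⟩
  have h2 := MonoidHom.card_fiber_eq_of_mem_range (powMonoidHom d : G →* G) (x := y ^ d) (y := 1)
    ⟨y, rfl⟩ ⟨1, one_pow d⟩
  simp only [powMonoidHom_apply] at h2
  rw [h1, h2, card_filter_pow_eq_one, Nat.gcd_eq_right hd]

lemma card_filter_eq_card_units_add (P : F → Prop) [DecidablePred P] :
    #{x : F | P x} = #{x : Fˣ | P x} + if P 0 then 1 else 0 := by
  have h1 : ({x : F | P x} : Finset F) =
      (({x : Fˣ | P x} : Finset Fˣ).image Units.val) ∪ (if P 0 then {0} else ∅) := by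
    ext x
    rcases eq_or_ne x 0 with rfl | hx
    · by_cases h0 : P 0 <;> simp [h0]
    · have : (x ∈ if P 0 then ({0} : Finset F) else ∅) ↔ False := by split_ifs <;> simp [hx]
      rw [mem_union, this, or_false]
      simp only [mem_filter, mem_univ, true_and, mem_image]
      exact ⟨fun h => ⟨Units.mk0 x hx, h, rfl⟩, by rintro ⟨y, hy, rfl⟩; exact hy⟩
  rw [h1, card_union_of_disjoint, card_image_of_injective _ Units.val_injective]
  · split_ifs <;> simp
  · split_ifs <;> simp

lemma dvd_card_form (hF : Fintype.card F = q ^ ℓ)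
    (hr : r = u * (2 * j + 1)) (hℓ : ℓ = u * (2 * m)) (t : F) :
    q ^ u + 1 ∣ #{z : Fˣ | frobTrace q ℓ (s * (z : F) ^ (q ^ r + 1)) = t} := by
  obtain ⟨e, he⟩ : q ^ u + 1 ∣ q ^ r + 1 := by
    have := Odd.nat_add_dvd_pow_add_pow (q ^ u) 1 (n := 2 * j + 1) ⟨j, rfl⟩
    rwa [one_pow, ← pow_mul, ← hr] at this
  have := dvd_card_filter_pow
    ((dvd_mul_left (q ^ u + 1) (q ^ u - 1)).trans (mul_dvd_card_units hF hℓ))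
    (fun y : Fˣ => frobTrace q ℓ (s * (y : F) ^ e) = t)
  simpa only [Units.val_pow_eq_pow_val, ← pow_mul, ← he] using this

lemma card_form_eq_of_ne_zero (hq : 2 ≤ q) (hF : Fintype.card F = q ^ ℓ) (hu : 0 < u)
    (hr : r = u * (2 * j + 1)) (hℓ : ℓ = u * (2 * m)) {t : F} (ht0 : t ≠ 0) (ht : t ^ q = t) :
    #{z : F | frobTrace q ℓ (s * z ^ (q ^ r + 1)) = t} =
      #{z : F | frobTrace q ℓ (s * z ^ (q ^ r + 1)) = 1} := by
  obtain ⟨ζ, hζ, hζt⟩ := exists_pow_add_one_eq hq hF hu hℓ ht0 ht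
  have hζ0 : ζ ≠ 0 := by
    rintro rfl
    exact ht0 (by rw [← hζt, zero_pow (by omega)])
  symm
  refine card_bijective (fun z => ζ * z) (Equiv.mulLeft₀ ζ hζ0).bijective fun z => ?_
  have h1 : ζ ^ (q ^ r + 1) = t := by
    rw [pow_succ, pow_pow_odd_mul hr hζ, ← pow_succ, hζt]
  rw [mem_filter_univ, mem_filter_univ, mul_pow, h1, mul_left_comm, frobTrace_mul_of_pow_eq ht]
  exact ⟨fun h => by rw [h, mul_one], fun h => mul_left_cancel₀ ht0 (by rw [h, mul_one])⟩

lemma card_filter_form_add_eq (hq : 2 ≤ q) (hF : Fintype.card F = q ^ ℓ)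
    (h : ∀ x y : F, (x + y) ^ q = x ^ q + y ^ q) (hℓ1 : 1 ≤ ℓ)
    (hr : r = u * (2 * j + 1)) (hℓ : ℓ = u * (2 * m)) (hg : (2 * r).gcd ℓ = 2 * u)
    (hs0 : s ≠ 0) (hs : s ^ q ^ r = -s) (w : F) :
    #{x : F | frobTrace q ℓ (s * (x + w) ^ (q ^ r + 1)) = frobTrace q ℓ (s * x ^ (q ^ r + 1))} =
      if w ^ q ^ (2 * r) = w then q ^ ℓ else q ^ (ℓ - 1) := by
  simp_rw [← sub_eq_zero (b := frobTrace q ℓ (s * _ ^ (q ^ r + 1))),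
    frobTrace_form_add_sub h hF hs]
  split_ifs with hw
  · have h1 : (s * w ^ (q ^ r + 1)) ^ q ^ r = -(s * w ^ (q ^ r + 1)) := by
      rw [mul_pow, hs, pow_succ, mul_pow, ← pow_mul, ← pow_add q, ← two_mul, hw, neg_mul,
        mul_comm w]
    have h2 : frobTrace q ℓ (s * w ^ (q ^ r + 1)) = 0 := by
      have := frobTrace_eq_zero_of_pow_eq_neg h (pow_pow_eq_neg h hF hr hg h1) m
      rwa [← hℓ] at this
    simp [hw, h2, frobTrace_zero h, hF]
  · have hv : s * (w - w ^ q ^ (2 * r)) ≠ 0 := mul_ne_zero hs0 (sub_ne_zero.mpr (Ne.symm hw))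
    have ht : (-frobTrace q ℓ (s * w ^ (q ^ r + 1))) ^ q = -frobTrace q ℓ (s * w ^ (q ^ r + 1)) := by
      rw [← frobTrace_neg h, frobTrace_pow_eq_self h hF]
    rw [← card_filter_frobTrace_eq h hq hℓ1 hF ht]
    refine card_bijective (fun x => s * (w - w ^ q ^ (2 * r)) * x ^ q ^ r)
      ((Equiv.mulLeft₀ _ hv).bijective.comp (pow_pow_bijective_of_add_pow h r)) fun x => ?_
    rw [mem_filter_univ, mem_filter_univ, add_eq_zero_iff_eq_neg]

lemma sum_card_filter_form_eq (hq : 2 ≤ q) (hF : Fintype.card F = q ^ ℓ)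
    (h : ∀ x y : F, (x + y) ^ q = x ^ q + y ^ q) (hℓ1 : 1 ≤ ℓ)
    (hr : r = u * (2 * j + 1)) (hℓ : ℓ = u * (2 * m)) (hg : (2 * r).gcd ℓ = 2 * u)
    (hs0 : s ≠ 0) (hs : s ^ q ^ r = -s) :
    ∑ x : F, #{y : F | frobTrace q ℓ (s * y ^ (q ^ r + 1)) = frobTrace q ℓ (s * x ^ (q ^ r + 1))} =
      q ^ (2 * u) * q ^ ℓ + (q ^ ℓ - q ^ (2 * u)) * q ^ (ℓ - 1) := by
  have h1 (x : F) :
      #{y : F | frobTrace q ℓ (s * y ^ (q ^ r + 1)) = frobTrace q ℓ (s * x ^ (q ^ r + 1))} =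
      #{w : F | frobTrace q ℓ (s * (x + w) ^ (q ^ r + 1)) =
        frobTrace q ℓ (s * x ^ (q ^ r + 1))} := by
    symm
    refine card_bijective (fun w => x + w) (Equiv.addLeft x).bijective fun w => ?_
    rw [mem_filter_univ, mem_filter_univ]
  have h2 := card_filter_pow_pow_eq_self (F := F) hq hF (2 * r)
  rw [hg] at h2
  have h3 := card_filter_add_card_filter_not (s := (univ : Finset F))
    (fun w : F => w ^ q ^ (2 * r) = w)
  rw [h2, card_univ, hF] at h3
  simp_rw [h1, card_filter]
  rw [sum_comm]
  simp_rw [← card_filter, card_filter_form_add_eq hq hF h hℓ1 hr hℓ hg hs0 hs]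
  rw [sum_ite, sum_const, sum_const, h2, smul_eq_mul, smul_eq_mul, ← h3, Nat.add_sub_cancel_left]

lemma card_form_zero_add (hq : 2 ≤ q) (hF : Fintype.card F = q ^ ℓ)
    (h : ∀ x y : F, (x + y) ^ q = x ^ q + y ^ q) (hu : 0 < u)
    (hr : r = u * (2 * j + 1)) (hℓ : ℓ = u * (2 * m)) :
    #{z : F | frobTrace q ℓ (s * z ^ (q ^ r + 1)) = 0} +
      (q - 1) * #{z : F | frobTrace q ℓ (s * z ^ (q ^ r + 1)) = 1} = q ^ ℓ := by
  have hmaps : Set.MapsTo (fun z : F => frobTrace q ℓ (s * z ^ (q ^ r + 1)))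
      (univ : Finset F) ({t : F | t ^ q = t} : Finset F) := fun z _ => by
    simp [frobTrace_pow_eq_self h hF]
  have h0 : (0 : F) ∈ ({t : F | t ^ q = t} : Finset F) := by simp; omega
  have h1 := card_eq_sum_card_fiberwise hmaps
  rw [card_univ, hF, ← add_sum_erase _ _ h0, sum_const_nat
    (m := #{z : F | frobTrace q ℓ (s * z ^ (q ^ r + 1)) = 1}), card_erase_of_mem h0,
    card_filter_pow_eq_self hq hF] at h1
  · exact h1.symm
  · intro t ht
    rw [mem_erase, mem_filter_univ] at ht
    exact card_form_eq_of_ne_zero hq hF hu hr hℓ ht.1 ht.2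

lemma int_eq_of_sq_eq_of_dvd_sub_one {D c : ℤ} {k : ℕ} (hc : 2 ≤ c) (hD : D ^ 2 = (c ^ k) ^ 2)
    (hdvd : c + 1 ∣ D - 1) : D = (-1) ^ k * c ^ k := by
  have h1 : c + 1 ∣ c ^ k - (-1) ^ k := by simpa using sub_dvd_pow_sub_pow c (-1) k
  have h2 : ¬ c + 1 ∣ 2 := fun h => by have := Int.le_of_dvd two_pos h; omega
  rcases sq_eq_sq_iff_eq_or_eq_neg.mp hD with rfl | rfl <;>
    rcases neg_one_pow_eq_or ℤ k with hk | hk <;> rw [hk] at h1 ⊢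
  · ring
  · exact absurd ((dvd_sub h1 hdvd).trans (dvd_of_eq (by ring))) h2
  · exact absurd ((dvd_neg.mpr (dvd_add h1 hdvd)).trans (dvd_of_eq (by ring))) h2
  · ring

/-- The difference between the number of zeros of the form `frobTrace (s * z ^ (q ^ r + 1))` and
the number of solutions at the value `1`. -/
lemma card_form_zero_sub_card_form_one (hq : 2 ≤ q) (hF : Fintype.card F = q ^ ℓ)
    (h : ∀ x y : F, (x + y) ^ q = x ^ q + y ^ q) (hu : 0 < u) (hm : 0 < m)
    (hr : r = u * (2 * j + 1)) (hℓ : ℓ = u * (2 * m)) (hg : (2 * r).gcd ℓ = 2 * u)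
    (hs0 : s ≠ 0) (hs : s ^ q ^ r = -s) :
    (#{z : F | frobTrace q ℓ (s * z ^ (q ^ r + 1)) = 0} : ℤ) -
      #{z : F | frobTrace q ℓ (s * z ^ (q ^ r + 1)) = 1} =
      (-1) ^ (m + 1) * ((q : ℤ) ^ u) ^ (m + 1) := by
  have hℓ1 : 1 ≤ ℓ := by
    rw [hℓ]
    exact Nat.mul_pos hu (by omega)
  have hsum := card_form_zero_add (s := s) hq hF h hu hr hℓ
  have hsq := sum_card_filter_form_eq hq hF h hℓ1 hr hℓ hg hs0 hs
  have hA := card_filter_eq_card_units_add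
    (fun z : F => frobTrace q ℓ (s * z ^ (q ^ r + 1)) = 0)
  have hB := card_filter_eq_card_units_add
    (fun z : F => frobTrace q ℓ (s * z ^ (q ^ r + 1)) = 1)
  obtain ⟨k0, hk0⟩ := dvd_card_form (s := s) hF hr hℓ 0
  obtain ⟨k1, hk1⟩ := dvd_card_form (s := s) hF hr hℓ 1
  rw [hk0, if_pos (by simp [frobTrace_zero h])] at hA
  rw [hk1, if_neg (by simp [frobTrace_zero h])] at hB
  have hfib (x : F) :
      #{y : F | frobTrace q ℓ (s * y ^ (q ^ r + 1)) = frobTrace q ℓ (s * x ^ (q ^ r + 1))} =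
      if frobTrace q ℓ (s * x ^ (q ^ r + 1)) = 0 then
        #{z : F | frobTrace q ℓ (s * z ^ (q ^ r + 1)) = 0}
      else #{z : F | frobTrace q ℓ (s * z ^ (q ^ r + 1)) = 1} := by
    split_ifs with hx
    · rw [hx]
    · exact card_form_eq_of_ne_zero hq hF hu hr hℓ hx (frobTrace_pow_eq_self h hF _)
  have hcompl := card_filter_add_card_filter_not (s := (univ : Finset F))
    (fun z : F => frobTrace q ℓ (s * z ^ (q ^ r + 1)) = 0)
  simp_rw [hfib] at hsq
  rw [sum_ite, sum_const, sum_const, smul_eq_mul, smul_eq_mul] at hsq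
  rw [card_univ, hF] at hcompl
  set A := #{z : F | frobTrace q ℓ (s * z ^ (q ^ r + 1)) = 0}
  set B := #{z : F | frobTrace q ℓ (s * z ^ (q ^ r + 1)) = 1}
  have hqu : 2 ≤ q ^ u := hq.trans (Nat.le_self_pow hu.ne' q)
  refine int_eq_of_sq_eq_of_dvd_sub_one (by exact_mod_cast hqu) ?_
    ⟨(k0 : ℤ) - k1, by rw [hA, hB]; push_cast; ring⟩
  have hle : q ^ (2 * u) ≤ q ^ ℓ := Nat.pow_le_pow_right (by omega) (by rw [hℓ]; nlinarith)
  have hq1 : (q : ℤ) - 1 ≠ 0 := by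
    have : (2 : ℤ) ≤ q := by exact_mod_cast hq
    omega
  have hL : (q : ℤ) ^ ℓ = q * q ^ (ℓ - 1) := by rw [← pow_succ', Nat.sub_add_cancel hℓ1]
  zify [show 1 ≤ q by omega, hle] at hsum hsq hcompl
  have hpow : (((q : ℤ) ^ u) ^ (m + 1)) ^ 2 = q ^ (2 * u) * q ^ ℓ := by
    rw [← pow_mul, ← pow_mul, ← pow_add, hℓ]
    congr 1
    ring
  rw [hpow]
  refine mul_left_cancel₀ hq1 ?_
  rw [eq_sub_of_add_eq' hcompl] at hsq
  have hsq' : (q : ℤ) * (A * A + (q ^ ℓ - A) * B) =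
      q * (q ^ (2 * u) * q ^ ℓ) + (q ^ ℓ - q ^ (2 * u)) * q ^ ℓ := by
    rw [hsq]
    conv_rhs => rw [hL]
    rw [hL]
    ring
  rw [← hsum] at hsq' ⊢
  linear_combination hsq'

lemma card_filter_affine_eq (hF : Fintype.card F = q ^ ℓ)
    (h : ∀ x y : F, (x + y) ^ q = x ^ q + y ^ q) {a b c x₀ : F}
    (hx₀ : a ^ q ^ r * x₀ ^ q ^ (2 * r) + a * x₀ = -(b ^ q ^ r)) :
    #{x : F | frobTrace q ℓ (a * x ^ (q ^ r + 1) + b * x + c) = 0} =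
      #{z : F | frobTrace q ℓ (a * z ^ (q ^ r + 1)) =
        frobTrace q ℓ (a * x₀ ^ (q ^ r + 1) - c)} := by
  have hlin (y : F) : frobTrace q ℓ (y * (a * x₀ ^ q ^ r + b)) =
      -frobTrace q ℓ (a * x₀ * y ^ q ^ r) := by
    rw [← frobTrace_pow_pow hF r, mul_pow, add_pow_pow_of_add_pow h, mul_pow, ← pow_mul x₀,
      ← pow_add, ← two_mul, ← frobTrace_neg h]
    congr 1
    linear_combination y ^ q ^ r * hx₀
  symm
  refine card_bijective (fun z => z + x₀) (Equiv.addRight x₀).bijective fun z => ?_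
  have h1 : a * (z + x₀) ^ (q ^ r + 1) + b * (z + x₀) + c =
      a * z ^ (q ^ r + 1) + z * (a * x₀ ^ q ^ r + b) + a * x₀ * z ^ q ^ r +
        x₀ * (a * x₀ ^ q ^ r + b) + c := by
    rw [pow_succ, add_pow_pow_of_add_pow h]
    ring
  have h2 : a * x₀ * x₀ ^ q ^ r = a * x₀ ^ (q ^ r + 1) := by ring
  rw [mem_filter_univ, mem_filter_univ, h1, ← sub_eq_zero]
  simp only [frobTrace_add h, frobTrace_sub h, hlin, h2]
  ring_nf

lemma card_curve_eq (hq : 2 ≤ q) (hℓ : 1 ≤ ℓ) (hF : Fintype.card F = q ^ ℓ)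
    (h : ∀ x y : F, (x + y) ^ q = x ^ q + y ^ q) (g : F → F) :
    Nat.card {xy : F × F // xy.2 ^ q - xy.2 = g xy.1} =
      q * #{x : F | frobTrace q ℓ (g x) = 0} := by
  rw [Nat.card_eq_fintype_card, Fintype.card_subtype, card_filter, ← univ_product_univ,
    sum_product]
  simp_rw [← card_filter, card_filter_pow_sub_eq h hq hℓ hF]
  rw [sum_ite, sum_const, sum_const_zero, smul_eq_mul, add_zero, mul_comm]

lemma exists_ne_zero_of_not_bijective (h : ∀ x y : F, (x + y) ^ q = x ^ q + y ^ q) {a : F}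
    (hf : ¬ Function.Bijective (fun x : F => a ^ q ^ r * x ^ q ^ (2 * r) + a * x)) :
    ∃ w : F, w ≠ 0 ∧ a ^ q ^ r * w ^ q ^ (2 * r) + a * w = 0 := by
  by_contra! hw
  refine hf (Finite.injective_iff_bijective.mp fun x y hxy => ?_)
  by_contra hne
  refine hw (x - y) (sub_ne_zero.mpr hne) ?_
  rw [sub_pow_pow_of_add_pow h]
  linear_combination hxy

/-- Substituting `w * z` for `z`, where `w` is a nonzero root of the linearized polynomial
`a ^ q ^ r * X ^ q ^ (2 * r) + a * X`, makes the coefficient of the form antisymmetric under the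
`q ^ r`-power map. -/
lemma exists_card_form_eq {a w : F} (ha : a ≠ 0) (hw0 : w ≠ 0)
    (hw : a ^ q ^ r * w ^ q ^ (2 * r) + a * w = 0) :
    ∃ s : F, s ≠ 0 ∧ s ^ q ^ r = -s ∧ ∀ t : F,
      #{z : F | frobTrace q ℓ (a * z ^ (q ^ r + 1)) = t} =
        #{z : F | frobTrace q ℓ (s * z ^ (q ^ r + 1)) = t} := by
  refine ⟨a * w ^ (q ^ r + 1), mul_ne_zero ha (pow_ne_zero _ hw0), ?_, fun t => ?_⟩
  · rw [mul_pow, pow_succ, mul_pow, ← pow_mul, ← pow_add q, ← two_mul]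
    linear_combination w ^ q ^ r * hw
  · symm
    refine card_bijective (fun z => w * z) (Equiv.mulLeft₀ w hw0).bijective fun z => ?_
    rw [mem_filter_univ, mem_filter_univ, mul_pow, mul_assoc]

lemma exists_eq_mul_of_even_div_gcd (hℓ : 0 < ℓ) (hu : u = Nat.gcd ℓ r) (heven : Even (ℓ / u)) :
    0 < u ∧ ∃ m j, 0 < m ∧ ℓ = u * (2 * m) ∧ r = u * (2 * j + 1) ∧ (2 * r).gcd ℓ = 2 * u := by
  have hu0 : 0 < u := hu ▸ Nat.gcd_pos_of_pos_left r hℓ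
  obtain ⟨m, hm⟩ := heven.two_dvd
  have hℓm : ℓ = u * (2 * m) := by
    rw [← hm, Nat.mul_div_cancel' (hu ▸ Nat.gcd_dvd_left ℓ r)]
  have hru : r = u * (r / u) := (Nat.mul_div_cancel' (hu ▸ Nat.gcd_dvd_right ℓ r)).symm
  have hcop : Nat.Coprime (2 * m) (r / u) := by
    have := Nat.coprime_div_gcd_div_gcd (hu ▸ hu0 : 0 < Nat.gcd ℓ r)
    rwa [← hu, hm] at this
  obtain ⟨j, hj⟩ : Odd (r / u) := Nat.coprime_two_left.mp hcop.coprime_mul_right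
  refine ⟨hu0, m, j, ?_, hℓm, hj ▸ hru, ?_⟩
  · rcases Nat.eq_zero_or_pos m with rfl | h
    · omega
    · exact h
  · rw [hru, hℓm, show 2 * (u * (r / u)) = 2 * u * (r / u) by ring,
      show u * (2 * m) = 2 * u * m by ring, Nat.gcd_mul_left,
      Nat.Coprime.gcd_eq_one hcop.coprime_mul_left.symm, mul_one]

end

/-- Let `p` be prime, `q = p ^ n`, and `ℓ ≥ 2`, `r ≥ 1` with `ℓ / u` even,
`u = gcd(ℓ, r)`.  Let `a, b, c ∈ F_{q^ℓ}` with `a ≠ 0` and `f(x) = a^(q^r) x^(q^(2r)) + a x`.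
If `f` is not a permutation polynomial of `F_{q^ℓ}` but `f(x) = -b^(q^r)` has a solution
`x₀`, with `c₁ = a x₀^(q^r+1) - c`, then
`N_{ℓ,r}(a,b,c) = q^ℓ + (-1)^(ℓ/2u + 1) q^(ℓ/2 + u) (q-1)` if `T(c₁) = 0` and
`N_{ℓ,r}(a,b,c) = q^ℓ + (-1)^(ℓ/2u) q^(ℓ/2 + u)` if `T(c₁) ≠ 0`. -/
theorem stmt_10 (p n : ℕ) (hp : p.Prime) (hn : 1 ≤ n) (q : ℕ) (hq : q = p ^ n)
    (ℓ r : ℕ) (hℓ : 2 ≤ ℓ) (hr : 1 ≤ r)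
    (u : ℕ) (hu : u = Nat.gcd ℓ r) (heven : Even (ℓ / u))
    (F : Type) [Field F] [Fintype F] (hF : Fintype.card F = q ^ ℓ)
    (T : F → F) (hT : ∀ z : F, T z = ∑ i ∈ Finset.range ℓ, z ^ q ^ i)
    (a b c x₀ c₁ : F) (ha : a ≠ 0)
    (hnperm : ¬Function.Bijective (fun x : F => a ^ q ^ r * x ^ q ^ (2 * r) + a * x))
    (hx₀ : a ^ q ^ r * x₀ ^ q ^ (2 * r) + a * x₀ = -(b ^ q ^ r))
    (hc₁ : c₁ = a * x₀ ^ (q ^ r + 1) - c) :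
    (T c₁ = 0 →
      (Nat.card {xy : F × F //
          xy.2 ^ q - xy.2 = a * xy.1 ^ (q ^ r + 1) + b * xy.1 + c} : ℤ)
        = (q : ℤ) ^ ℓ
            + (-1 : ℤ) ^ (ℓ / (2 * u) + 1) * (q : ℤ) ^ (ℓ / 2 + u) * ((q : ℤ) - 1)) ∧
    (T c₁ ≠ 0 →
      (Nat.card {xy : F × F //
          xy.2 ^ q - xy.2 = a * xy.1 ^ (q ^ r + 1) + b * xy.1 + c} : ℤ)
        = (q : ℤ) ^ ℓ + (-1 : ℤ) ^ (ℓ / (2 * u)) * (q : ℤ) ^ (ℓ / 2 + u)) := by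
  classical
  have hq2 : 2 ≤ q := hq ▸ hp.two_le.trans (Nat.le_self_pow (by omega) p)
  have := Fact.mk hp
  have : CharP F p := charP_of_card_eq_prime_pow (f := n * ℓ) (by rw [hF, hq, pow_mul])
  have h (x y : F) : (x + y) ^ q = x ^ q + y ^ q := by rw [hq, add_pow_char_pow]
  obtain rfl : T = frobTrace q ℓ := funext hT
  obtain ⟨hu0, m, j, hm, hℓm, hrj, hg⟩ := exists_eq_mul_of_even_div_gcd (by omega) hu heven
  obtain ⟨w, hw0, hw⟩ := exists_ne_zero_of_not_bijective h hnperm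
  obtain ⟨s, hs0, hs, hcard⟩ := exists_card_form_eq (ℓ := ℓ) ha hw0 hw
  have hsum := card_form_zero_add (s := s) hq2 hF h hu0 hrj hℓm
  have hdiff := card_form_zero_sub_card_form_one hq2 hF h hu0 hm hrj hℓm hg hs0 hs
  rw [card_curve_eq hq2 (by omega) hF h (fun x => a * x ^ (q ^ r + 1) + b * x + c),
    card_filter_affine_eq hF h hx₀, ← hc₁, hcard]
  zify [show 1 ≤ q by omega] at hsum
  have he1 : ℓ / (2 * u) = m := by
    rw [hℓm, show u * (2 * m) = 2 * u * m by ring, Nat.mul_div_cancel_left _ (by omega)]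
  have he2 : ℓ / 2 + u = u * (m + 1) := by
    rw [hℓm, show u * (2 * m) = 2 * (u * m) by ring, Nat.mul_div_cancel_left _ two_pos]
    ring
  rw [he1, he2, pow_mul]
  constructor <;> intro ht
  · rw [ht]
    push_cast
    linear_combination hsum + ((q : ℤ) - 1) * hdiff
  · rw [card_form_eq_of_ne_zero hq2 hF hu0 hrj hℓm ht (frobTrace_pow_eq_self h hF _)]
    push_cast
    linear_combination hsum - hdiff
end

section
/- Let p be a prime, q = p^n, and let ℓ ≥ 2 and r ≥ 0 be integers with n·ℓ even. Let a, b, c ∈ F_{q^ℓ} with a ≠ 0, set f(x) = a^{q^r}·x^{q^{2r}} + a·x, and suppose there exists x₀ ∈ F_{q^ℓ} with f(x₀) = −b^{q^r} and T(a·x₀^{q^r+1} − c) = 0. Then N_{ℓ,r}(a,b,c) = q^ℓ + (q−1)·p^{nℓ/2 + nr} if and only if one of the following holds: (1) r = 0, ℓ is even, p ≡ 1 (mod 4), and a is not a square in F_{q^ℓ}; (2) r = 0, ℓ is even, p ≡ 3 (mod 4), and either nℓ/2 is odd and a is a square in F_{q^ℓ}, or nℓ/2 is even and a is not a square in F_{q^ℓ};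 (3) r ≥ 1, 2r divides ℓ with ℓ/(2r) odd, and the map x ↦ f(x) is not a bijection of F_{q^ℓ}. -/
section

open Finset

theorem sum_range_mul_blocks {M : Type*} [AddCommMonoid M] (f : ℕ → M) (m k : ℕ) :
    ∑ i ∈ range (m * k), f i = ∑ i ∈ range k, ∑ j ∈ range m, f (m * i + j) := by
  induction k with
  | zero => simp
  | succ k ih => rw [Nat.mul_succ, sum_range_add, ih, sum_range_succ]

theorem sum_pow_frobenius {F : Type*} [Field F] [Fintype F] {q ℓ : ℕ}
    (hF : Fintype.card F = q ^ ℓ) (i : ℕ) (z : F) :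
    ∑ j ∈ range ℓ, (z ^ q ^ i) ^ q ^ j = ∑ j ∈ range ℓ, z ^ q ^ j := by
  induction i with
  | zero => simp
  | succ i ih =>
    rw [← ih]
    set w := z ^ q ^ i
    have h1 := sum_range_succ' (fun j => w ^ q ^ j) ℓ
    rw [sum_range_succ, ← hF, FiniteField.pow_card, pow_zero, pow_one] at h1
    rw [add_right_cancel h1]
    refine sum_congr rfl fun j _ => ?_
    rw [pow_succ q i, pow_mul z, ← pow_mul, pow_succ', mul_comm]

theorem exists_primitive_addChar_eq_one_of_trace_eq_zero {F : Type*} [Field F] [Fintype F]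
    {p n ℓ : ℕ} (hp : p.Prime) [CharP F p] (hF : Fintype.card F = (p ^ n) ^ ℓ) :
    ∃ Ψ : AddChar F ℂ, Ψ.IsPrimitive ∧
      (∀ z : F, ∑ i ∈ range ℓ, z ^ (p ^ n) ^ i = 0 → Ψ z = 1) ∧ ∀ z : F, Ψ (z ^ p) = Ψ z := by
  have : Fact p.Prime := ⟨hp⟩
  let : Algebra (ZMod p) F := ZMod.algebra F p
  have hrank : Module.finrank (ZMod p) F = n * ℓ := by
    have h := Module.card_eq_pow_finrank (K := ZMod p) (V := F)
    rw [hF, ZMod.card, ← pow_mul] at h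
    exact (Nat.pow_right_injective hp.two_le h).symm
  refine ⟨(ZMod.stdAddChar (N := p)).compAddMonoidHom
    (Algebra.trace (ZMod p) F).toAddMonoidHom, ?_, ?_, ?_⟩
  · refine AddChar.IsPrimitive.of_ne_one fun h => ?_
    obtain ⟨x, hx⟩ := Algebra.trace_surjective (ZMod p) F 1
    have h1 := DFunLike.congr_fun h x
    simp only [AddChar.compAddMonoidHom_apply, AddChar.one_apply] at h1
    have h2 : ZMod.stdAddChar (1 : ZMod p) = 1 := by
      rw [← hx]; exact h1
    rw [← (ZMod.stdAddChar (N := p)).map_zero_eq_one] at h2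
    exact one_ne_zero (ZMod.injective_stdAddChar h2)
  · intro z hz
    have h0 : Algebra.trace (ZMod p) F z = 0 := by
      apply (algebraMap (ZMod p) F).injective
      rw [FiniteField.algebraMap_trace_eq_sum_pow, hrank, Nat.card_zmod, sum_range_mul_blocks,
        sum_comm, map_zero]
      refine sum_eq_zero fun j _ => ?_
      have : ∑ i ∈ range ℓ, z ^ p ^ (n * i + j) = (∑ i ∈ range ℓ, z ^ (p ^ n) ^ i) ^ p ^ j := by
        rw [sum_pow_char_pow]
        exact sum_congr rfl fun i _ => by
          rw [← pow_mul z, ← pow_mul p, pow_add]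
      rw [this, hz, zero_pow (pow_pos hp.pos j).ne']
    change ZMod.stdAddChar (Algebra.trace (ZMod p) F z) = 1
    rw [h0, AddChar.map_zero_eq_one]
  · intro z
    have hFp : Fintype.card F = p ^ (n * ℓ) := by rw [hF, pow_mul]
    have h0 : Algebra.trace (ZMod p) F (z ^ p) = Algebra.trace (ZMod p) F z := by
      apply (algebraMap (ZMod p) F).injective
      rw [FiniteField.algebraMap_trace_eq_sum_pow, FiniteField.algebraMap_trace_eq_sum_pow, hrank,
        Nat.card_zmod]
      simpa using sum_pow_frobenius hFp 1 z
    change ZMod.stdAddChar (Algebra.trace (ZMod p) F (z ^ p)) =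
      ZMod.stdAddChar (Algebra.trace (ZMod p) F z)
    rw [h0]

/-- The exponential sum attached to the form `x ↦ a x ^ (s + 1)`. -/
noncomputable def formSum {F : Type*} [Field F] [Fintype F] (Ψ : AddChar F ℂ) (s : ℕ) (a : F) :
    ℂ := ∑ x : F, Ψ (a * x ^ (s + 1))

section
variable {F : Type*} [Field F] [Fintype F] [DecidableEq F] {Ψ : AddChar F ℂ}

theorem pow_injective_of_add {F : Type*} [Field F] {s : ℕ} (hs : s ≠ 0)
    (hadd : ∀ x y : F, (x + y) ^ s = x ^ s + y ^ s) : Function.Injective fun x : F => x ^ s := by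
  intro x y hxy
  have h := hadd (x - y) y
  simp only [sub_add_cancel] at h hxy
  rw [hxy, right_eq_add] at h
  exact sub_eq_zero.mp (pow_eq_zero_iff hs |>.mp h)

theorem formSum_mul_conj (hΨ : Ψ.IsPrimitive) {s : ℕ} (hs : s ≠ 0)
    (hadd : ∀ x y : F, (x + y) ^ s = x ^ s + y ^ s) (hinv : ∀ z, Ψ (z ^ s) = Ψ z) (a : F) :
    formSum Ψ s a * starRingEnd ℂ (formSum Ψ s a) = Fintype.card F *
      ∑ x : F with a ^ s * (x ^ s) ^ s + a * x = 0, Ψ (a * x ^ (s + 1)) := by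
  have hinj := pow_injective_of_add hs hadd
  have hbij : Function.Bijective fun x : F => x ^ s := Finite.injective_iff_bijective.mp hinj
  unfold formSum
  rw [map_sum, sum_mul_sum, sum_comm]
  have h1 : ∀ y : F, ∑ x : F, Ψ (a * x ^ (s + 1)) * starRingEnd ℂ (Ψ (a * y ^ (s + 1))) =
      ∑ x : F, Ψ (a * x ^ (s + 1)) * Ψ (y ^ s * (a ^ s * (x ^ s) ^ s + a * x)) := by
    intro y
    rw [← Equiv.sum_comp (Equiv.addRight y)
      fun x => Ψ (a * x ^ (s + 1)) * starRingEnd ℂ (Ψ (a * y ^ (s + 1)))]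
    refine sum_congr rfl fun x _ => ?_
    rw [← AddChar.map_neg_eq_conj, ← AddChar.map_add_eq_mul, Equiv.coe_addRight]
    have h2 : Ψ (y ^ s * (a ^ s * (x ^ s) ^ s + a * x)) = Ψ (a * x ^ s * y + a * x * y ^ s) := by
      rw [AddChar.map_add_eq_mul, ← hinv (a * x ^ s * y), ← AddChar.map_add_eq_mul]
      congr 1
      rw [mul_pow, mul_pow]; ring
    rw [h2, ← AddChar.map_add_eq_mul]
    congr 1
    rw [pow_succ, pow_succ, pow_succ, hadd]; ring
  rw [sum_congr rfl fun y _ => h1 y, sum_comm, mul_sum, sum_filter]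
  refine sum_congr rfl fun x _ => ?_
  rw [← mul_sum, hbij.sum_comp (fun y => Ψ (y * (a ^ s * (x ^ s) ^ s + a * x))),
    AddChar.sum_mulShift _ hΨ]
  split_ifs <;> simp [mul_comm]

theorem card_solutions_eq_sum (hΨ : Ψ.IsPrimitive) {q : ℕ} (hq : q ≠ 0)
    (hadd : ∀ x y : F, (x + y) ^ q = x ^ q + y ^ q) (hinv : ∀ z, Ψ (z ^ q) = Ψ z) (g : F → F) :
    (Nat.card {xy : F × F // xy.2 ^ q - xy.2 = g xy.1} : ℂ) =
      ∑ t : F with t ^ q = t, ∑ x : F, Ψ (t * g x) := by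
  have hinj := pow_injective_of_add hq hadd
  have hbij : Function.Bijective fun x : F => x ^ q := Finite.injective_iff_bijective.mp hinj
  have hc : (Fintype.card F : ℂ) ≠ 0 := by exact_mod_cast Fintype.card_ne_zero
  rw [Nat.card_eq_fintype_card, Fintype.card_subtype, ← mul_right_inj' hc, card_filter]
  push_cast
  rw [Fintype.sum_prod_type, mul_sum]
  have h1 : ∀ x y : F, (Fintype.card F : ℂ) * (if y ^ q - y = g x then 1 else 0) =
      ∑ t : F, Ψ (t * (g x - (y ^ q - y))) := by
    intro x y
    rw [AddChar.sum_mulShift _ hΨ]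
    simp [sub_eq_zero, eq_comm]
  have h2 : ∀ t : F, ∑ y : F, Ψ (-(t * (y ^ q - y))) = 
      if t ^ q = t then (Fintype.card F : ℂ) else 0 := by
    intro t
    have : ∀ y, Ψ (-(t * (y ^ q - y))) = Ψ (y ^ q * (t ^ q - t)) := by
      intro y
      have h3 : -(t * (y ^ q - y)) = t * y + -(t * y ^ q) := by ring
      rw [h3, AddChar.map_add_eq_mul, ← hinv (t * y), ← AddChar.map_add_eq_mul]
      congr 1; rw [mul_pow]; ring
    simp_rw [this]
    rw [hbij.sum_comp (fun y => Ψ (y * (t ^ q - t))), AddChar.sum_mulShift _ hΨ]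
    simp [sub_eq_zero]
  calc _ = ∑ x : F, ∑ y : F, ∑ t : F, Ψ (t * (g x - (y ^ q - y))) := by
        simp_rw [mul_sum, h1]
    _ = ∑ t : F, ∑ x : F, ∑ y : F, Ψ (t * g x) * Ψ (-(t * (y ^ q - y))) := by
        simp_rw [← AddChar.map_add_eq_mul]
        rw [sum_congr rfl fun x _ => sum_comm, sum_comm]
        refine sum_congr rfl fun t _ => sum_congr rfl fun x _ => sum_congr rfl fun y _ => ?_
        congr 1; ring
    _ = _ := by
        simp_rw [← mul_sum, h2]
        rw [mul_sum, sum_filter]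
        refine sum_congr rfl fun t _ => ?_
        rw [← sum_mul]
        split_ifs <;> simp [mul_comm]
end

theorem card_units_filter_pow {F : Type*} [Field F] [Fintype F] [DecidableEq F] (k : ℕ) :
    #{u : Fˣ | u ^ k = 1} = (Fintype.card F - 1).gcd k := by
  have h := IsCyclic.card_powMonoidHom_ker (G := Fˣ) k
  rw [Nat.card_eq_fintype_card (α := Fˣ), Fintype.card_units] at h
  rw [← h, Nat.card_eq_fintype_card, ← Fintype.card_subtype]
  exact Fintype.card_congr (Equiv.refl _)

theorem card_filter_pow_eq_self_s12 {F : Type*} [Field F] [Fintype F] [DecidableEq F] {k : ℕ}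
    (hk : 1 ≤ k) : #{z : F | z ^ k = z} = (Fintype.card F - 1).gcd (k - 1) + 1 := by
  rw [← card_units_filter_pow]
  obtain ⟨k, rfl⟩ := Nat.exists_eq_add_of_le' hk
  have h : ({z : F | z ^ (k + 1) = z} : Finset F) =
      insert 0 (({u : Fˣ | u ^ k = 1} : Finset Fˣ).map ⟨Units.val, Units.val_injective⟩) := by
    ext z
    simp only [mem_filter, mem_univ, true_and, mem_insert, mem_map, Function.Embedding.coeFn_mk]
    constructor
    · intro hz
      by_cases h0 : z = 0
      · exact .inl h0
      · refine .inr ⟨Units.mk0 z h0, ?_, rfl⟩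
        ext
        simpa [pow_succ, h0] using hz
    · rintro (rfl | ⟨u, hu, rfl⟩)
      · simp
      · rw [pow_succ, ← Units.val_pow_eq_pow_val, hu]; simp
  rw [h, card_insert_of_notMem (by simp), card_map, Nat.add_sub_cancel]

theorem sum_units_pow {F : Type*} [Field F] [Fintype F] [DecidableEq F] {k : ℕ}
    (hk : k ∣ Fintype.card F - 1) (h : Fˣ → ℂ) :
    ∑ u : Fˣ, h (u ^ k) = k * ∑ v : Fˣ with v ∈ Set.range fun u : Fˣ => u ^ k, h v := by
  rw [← sum_fiberwise_of_maps_to (s := univ) (g := fun u : Fˣ => u ^ k)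
    (t := {v : Fˣ | v ∈ Set.range fun u : Fˣ => u ^ k}) (by simp), mul_sum]
  refine sum_congr rfl fun v hv => ?_
  have hc : #{u : Fˣ | u ^ k = v} = k := by
    have h1 := MonoidHom.card_fiber_eq_of_mem_range (powMonoidHom k : Fˣ →* Fˣ)
      (x := v) (y := 1) (by simpa using hv) ⟨1, by simp⟩
    simp only [powMonoidHom_apply] at h1
    rw [h1, card_units_filter_pow, Nat.gcd_eq_right hk]
  rw [sum_congr rfl (g := fun _ => h v) (fun u hu => by rw [(mem_filter.mp hu).2]), sum_const, hc,
    nsmul_eq_mul]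

theorem card_radical {F : Type*} [Field F] [Fintype F] [DecidableEq F] {q ℓ r : ℕ} (hq : 2 ≤ q)
    (hF : Fintype.card F = q ^ ℓ) {a x₁ : F} (ha : a ≠ 0) (hx₁ : x₁ ≠ 0)
    (h : a ^ q ^ r * (x₁ ^ q ^ r) ^ q ^ r + a * x₁ = 0) :
    #{x : F | a ^ q ^ r * (x ^ q ^ r) ^ q ^ r + a * x = 0} = q ^ (2 * r).gcd ℓ := by
  have hpos : 1 ≤ q ^ (2 * r) := Nat.one_le_pow _ _ (by omega)
  have hpp : ∀ x : F, (x ^ q ^ r) ^ q ^ r = x ^ q ^ (2 * r) := fun x => by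
    rw [← pow_mul, ← pow_add, two_mul]
  have hW : ({x : F | a ^ q ^ r * (x ^ q ^ r) ^ q ^ r + a * x = 0} : Finset F) =
      ({z : F | z ^ q ^ (2 * r) = z} : Finset F).map 
        ⟨fun z => z * x₁, mul_left_injective₀ hx₁⟩ := by
    have key : ∀ z : F, a ^ q ^ r * (z * x₁) ^ q ^ (2 * r) + a * (z * x₁) = 0 ↔
        z ^ q ^ (2 * r) = z := fun z => by
      rw [hpp] at h
      have h1 : a ^ q ^ r * (z * x₁) ^ q ^ (2 * r) + a * (z * x₁) =
          a * x₁ * (z - z ^ q ^ (2 * r)) := by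
        rw [mul_pow]; linear_combination z ^ q ^ (2 * r) * h
      rw [h1, mul_eq_zero_iff_left (mul_ne_zero ha hx₁), sub_eq_zero, eq_comm]
    ext x
    simp only [hpp, mem_filter, mem_univ, true_and, mem_map, Function.Embedding.coeFn_mk]
    constructor
    · intro hx
      have hxz : x / x₁ * x₁ = x := div_mul_cancel₀ x hx₁
      exact ⟨x / x₁, (key _).mp (by rwa [hxz]), hxz⟩
    · rintro ⟨z, hz, rfl⟩
      exact (key z).mpr hz
  rw [hW, card_map, card_filter_pow_eq_self_s12 hpos, hF, Nat.gcd_comm, Nat.pow_sub_one_gcd_pow_sub_one,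
    Nat.sub_add_cancel (Nat.one_le_pow _ _ (by omega))]

theorem sum_addChar_shift {F : Type*} [Field F] [Fintype F] {Ψ : AddChar F ℂ} (T : F →+ F)
    {s : ℕ} (hadd : ∀ x y : F, (x + y) ^ s = x ^ s + y ^ s) (hTs : ∀ z, T (z ^ s) = T z)
    (hΨT : ∀ z, T z = 0 → Ψ z = 1) {t : F} (ht : ∀ z, T (t * z) = t * T z) {a b c x₀ : F}
    (hx₀ : a ^ s * (x₀ ^ s) ^ s + a * x₀ = -(b ^ s)) (hT : T (a * x₀ ^ (s + 1) - c) = 0) :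
    ∑ x : F, Ψ (t * (a * x ^ (s + 1) + b * x + c)) = formSum Ψ s (t * a) := by
  rw [formSum, ← Equiv.sum_comp (Equiv.addRight x₀)]
  refine sum_congr rfl fun x _ => ?_
  rw [Equiv.coe_addRight]
  set D : F := a * x ^ s * x₀ + (b + a * x₀ ^ s) * x + (b * x₀ + a * x₀ ^ (s + 1) + c) with hD
  have hsplit : t * (a * (x + x₀) ^ (s + 1) + b * (x + x₀) + c) =
      t * a * x ^ (s + 1) + t * D := by
    rw [hD, pow_succ, hadd]; ring
  have hB : T ((b + a * x₀ ^ s) * x) = -T (a * x ^ s * x₀) := by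
    rw [← hTs, ← map_neg]
    congr 1
    rw [mul_pow, hadd, mul_pow]
    linear_combination x ^ s * hx₀
  have hC : T (b * x₀) = -T (a * x₀ ^ (s + 1)) - T (a * x₀ ^ (s + 1)) := by
    nth_rewrite 2 [← hTs (a * x₀ ^ (s + 1))]
    rw [← hTs, ← map_neg, ← map_sub]
    congr 1
    rw [mul_pow, mul_pow, pow_succ, mul_pow]
    linear_combination x₀ ^ s * hx₀
  have hTD : T D = 0 := by
    rw [map_sub] at hT
    rw [hD, map_add, map_add, map_add, map_add, hB, hC]
    linear_combination -hT
  rw [hsplit, AddChar.map_add_eq_mul, hΨT (t * D) (by rw [ht, hTD, mul_zero]), mul_one]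

theorem isIntegral_addChar {F : Type*} [Field F] [Fintype F] (Ψ : AddChar F ℂ) (z : F) :
    IsIntegral ℤ (Ψ z) := by
  refine IsIntegral.of_pow (n := Fintype.card F) Fintype.card_pos ?_
  rw [← AddChar.map_nsmul_eq_pow, card_nsmul_eq_zero, AddChar.map_zero_eq_one]
  exact isIntegral_one

theorem formSum_eq_one_add_mul {F : Type*} [Field F] [Fintype F] (Ψ : AddChar F ℂ) {s : ℕ}
    (hs : s + 1 ∣ Fintype.card F - 1) (a : F) :
    ∃ A : ℂ, IsIntegral ℤ A ∧ formSum Ψ s a = 1 + (s + 1) * A := by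
  classical
  refine ⟨∑ v : Fˣ with v ∈ Set.range fun u : Fˣ => u ^ (s + 1), Ψ (a * v),
    IsIntegral.sum _ fun v _ => isIntegral_addChar Ψ (a * v), ?_⟩
  have h := sum_units_pow hs fun v : Fˣ => Ψ (a * v)
  push_cast at h
  rw [← h, formSum, Fintype.sum_eq_add_sum_subtype_ne _ (0 : F)]
  congr 1
  · simp
  · exact (Fintype.sum_equiv unitsEquivNeZero _ _ fun u => by simp [unitsEquivNeZero]).symm

theorem formSum_mul_pow {F : Type*} [Field F] [Fintype F] (Ψ : AddChar F ℂ) (s : ℕ) (a : F) {w : F}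
    (hw : w ≠ 0) : formSum Ψ s (a * w ^ (s + 1)) = formSum Ψ s a := by
  rw [formSum, formSum, ← Equiv.sum_comp (Equiv.mulLeft₀ w hw)
    fun x => Ψ (a * x ^ (s + 1))]
  refine sum_congr rfl fun x _ => ?_
  rw [Equiv.mulLeft₀_apply, mul_pow, mul_assoc]

theorem conj_formSum {F : Type*} [Field F] [Fintype F] (Ψ : AddChar F ℂ) (s : ℕ) (a : F) :
    starRingEnd ℂ (formSum Ψ s a) = formSum Ψ s (-a) := by
  rw [formSum, formSum, map_sum]
  exact sum_congr rfl fun x _ => by rw [← AddChar.map_neg_eq_conj, neg_mul]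

theorem exists_pow_eq_neg_one {F : Type*} [Field F] [Fintype F] {s m : ℕ}
    (hF : Fintype.card F = s ^ (2 * m)) : ∃ w : F, w ^ (s + 1) = -1 := by
  by_cases h2 : ringChar F = 2
  · have : CharP F 2 := ringChar.of_eq h2
    exact ⟨1, by rw [one_pow, CharTwo.neg_eq]⟩
  · obtain ⟨g, hg⟩ := FiniteField.exists_nonsquare h2
    have hg0 : g ≠ 0 := fun h => hg (h ▸ IsSquare.zero)
    have hodd := FiniteField.odd_card_of_char_ne_two h2
    have hgp : g ^ (Fintype.card F / 2) = -1 :=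
      (FiniteField.pow_dichotomy h2 hg0).resolve_left fun h =>
        hg ((FiniteField.isSquare_iff h2 hg0).mpr h)
    have hs : Odd s := by
      have h3 : Odd (s ^ (2 * m)) := hF ▸ Nat.odd_iff.mpr hodd
      by_cases hm : m = 0
      · subst hm
        have := Fintype.one_lt_card (α := F)
        simp [hF] at this
      · exact (Nat.odd_pow_iff (by omega)).mp h3
    obtain ⟨k, rfl⟩ := hs
    obtain ⟨j, hj⟩ : (2 * k + 1) ^ 2 - 1 ∣ ((2 * k + 1) ^ 2) ^ m - 1 :=
      Nat.sub_one_dvd_pow_sub_one _ _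
    have hsq : (2 * k + 1) ^ 2 - 1 = 2 * ((2 * k + 1 + 1) * k) := by
      rw [Nat.sub_eq_iff_eq_add (Nat.one_le_pow _ _ (by omega))]; ring
    refine ⟨g ^ (k * j), ?_⟩
    rw [← pow_mul, ← hgp]
    congr 1
    rw [hsq, ← pow_mul, ← hF] at hj
    have : Fintype.card F / 2 = (2 * k + 1 + 1) * k * j := by
      rw [mul_assoc 2] at hj; omega
    rw [this]; ring

theorem eq_neg_one_pow_of_dvd {s m : ℕ} (hs : 2 ≤ s) {ε k : ℤ} (hε : ε = 1 ∨ ε = -1)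
    (h : ε * s ^ (m + 1) = 1 + (s + 1) * k) : ε = (-1) ^ (m + 1) := by
  have hmod : (ε * (-1) ^ (m + 1) : ℤ) ≡ 1 [ZMOD (s + 1)] := by
    have h1 : (s : ℤ) ≡ -1 [ZMOD (s + 1)] := (Int.modEq_iff_dvd.mpr ⟨-1, by ring⟩)
    calc (ε * (-1) ^ (m + 1) : ℤ) ≡ ε * s ^ (m + 1) [ZMOD (s + 1)] := ((h1.pow _).mul_left _).symm
      _ ≡ 1 [ZMOD (s + 1)] := by
        rw [h]; exact (Int.modEq_iff_dvd.mpr ⟨-k, by ring⟩)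
  have hd := Int.modEq_iff_dvd.mp hmod
  have hsz : (2 : ℤ) ≤ s := by exact_mod_cast hs
  have h2 : ¬ ((s : ℤ) + 1 ∣ 2) := fun hd => by
    have := Int.le_of_dvd (by norm_num) hd
    omega
  rcases hε with rfl | rfl <;> rcases neg_one_pow_eq_or ℤ (m + 1) with h' | h' <;>
    rw [h'] at hd ⊢ <;> norm_num at hd h2 ⊢ <;> exact absurd hd h2

theorem sum_pow_eq_zero_of_pow_eq_neg {F : Type*} [Field F] {q r m : ℕ} {v : F}
    (hv : v ^ q ^ r = -v) (hneg : ∀ i, ∀ z : F, (-z) ^ q ^ i = -z ^ q ^ i) :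
    ∑ i ∈ range (2 * r * m), v ^ q ^ i = 0 := by
  rw [mul_comm 2 r, sum_range_mul_blocks]
  refine sum_eq_zero fun i _ => ?_
  have hv2 : ∀ i : ℕ, v ^ q ^ (r * 2 * i) = v := fun i => by
    induction i with
    | zero => simp
    | succ i ih =>
      rw [show r * 2 * (i + 1) = r * 2 * i + r + r by ring, pow_add, pow_add, pow_mul, pow_mul, ih, hv,
        hneg, hv, neg_neg]
  rw [sum_congr rfl fun j _ => show v ^ q ^ (r * 2 * i + j) = v ^ q ^ j by
    rw [pow_add, pow_mul v, hv2]]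
  rw [mul_two, sum_range_add, ← sum_add_distrib]
  refine sum_eq_zero fun j _ => ?_
  rw [pow_add, pow_mul, hv, hneg, add_neg_cancel]

theorem formSum_eq_of_radical {F : Type*} [Field F] [Fintype F] [DecidableEq F] {Ψ : AddChar F ℂ}
    (hΨ : Ψ.IsPrimitive) {s m : ℕ} (hs : 2 ≤ s) (hF : Fintype.card F = s ^ (2 * m))
    (hadd : ∀ x y : F, (x + y) ^ s = x ^ s + y ^ s) (hinv : ∀ z, Ψ (z ^ s) = Ψ z) {a : F}
    (hcard : #{x : F | a ^ s * (x ^ s) ^ s + a * x = 0} = s ^ 2)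
    (hiso : ∀ x : F, a ^ s * (x ^ s) ^ s + a * x = 0 → Ψ (a * x ^ (s + 1)) = 1) :
    formSum Ψ s a = (-1) ^ (m + 1) * s ^ (m + 1) := by
  have hdvd : s + 1 ∣ Fintype.card F - 1 := by
    rw [hF, pow_mul]
    refine Dvd.dvd.trans ⟨s - 1, ?_⟩ (Nat.sub_one_dvd_pow_sub_one (s ^ 2) m)
    rw [← Nat.sq_sub_sq, one_pow]
  obtain ⟨A, hA, hSA⟩ := formSum_eq_one_add_mul Ψ hdvd a
  obtain ⟨w, hw⟩ := exists_pow_eq_neg_one hF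
  have hw0 : w ≠ 0 := by
    rintro rfl
    rw [zero_pow (by omega)] at hw
    exact neg_ne_zero.mpr one_ne_zero hw.symm
  have hnorm := formSum_mul_conj hΨ (by omega) hadd hinv a
  rw [conj_formSum, ← mul_neg_one a, ← hw, formSum_mul_pow Ψ s a hw0,
    sum_congr rfl (g := fun _ => 1) (fun x hx => hiso x (mem_filter.mp hx).2), sum_const, hcard, hF]
    at hnorm
  obtain ⟨ε, hε, hSε⟩ : ∃ ε : ℤ, (ε = 1 ∨ ε = -1) ∧ formSum Ψ s a = ε * s ^ (m + 1) := by
    have h : formSum Ψ s a * formSum Ψ s a = s ^ (m + 1) * s ^ (m + 1) := by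
      rw [hnorm]; push_cast; rw [nsmul_one]; push_cast; ring
    rcases mul_self_eq_mul_self_iff.mp h with h | h
    · exact ⟨1, .inl rfl, by rw [h]; simp⟩
    · exact ⟨-1, .inr rfl, by rw [h]; simp⟩
  have hs1 : (s : ℂ) + 1 ≠ 0 := by exact_mod_cast Nat.succ_ne_zero s
  obtain ⟨k, hk⟩ : ∃ k : ℤ, A = k := by
    have hAq : A = ((ε * s ^ (m + 1) - 1) / (s + 1) : ℚ) := by
      push_cast
      rw [eq_div_iff hs1]
      linear_combination hSε - hSA
    rw [hAq] at hA
    have hQ : IsIntegral ℤ ((ε * s ^ (m + 1) - 1) / (s + 1) : ℚ) :=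
      (isIntegral_algebraMap_iff (algebraMap ℚ ℂ).injective).mp hA
    obtain ⟨k, hk⟩ := IsIntegrallyClosed.isIntegral_iff.mp hQ
    exact ⟨k, by rw [hAq, ← hk]; simp⟩
  have hεk : ε * s ^ (m + 1) = 1 + (s + 1) * k := by
    rw [hSε, hk] at hSA
    exact_mod_cast hSA
  rw [hSε, eq_neg_one_pow_of_dvd hs hε hεk]
  push_cast; rfl

theorem formSum_one_eq_of_pow_eq_neg {F : Type*} [Field F] [Fintype F] [DecidableEq F]
    {Ψ : AddChar F ℂ} (hΨ : Ψ.IsPrimitive) (h2 : ringChar F ≠ 2) {s : ℕ} (hs : s ≠ 0)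
    (hF : Fintype.card F = s ^ 2) (hadd : ∀ x y : F, (x + y) ^ s = x ^ s + y ^ s)
    (hinv : ∀ z, Ψ (z ^ s) = Ψ z) {y : F} (hy0 : y ≠ 0) (hy : y ^ s = -y) :
    formSum Ψ 1 y = s := by
  have hs1 : 1 ≤ s := Nat.one_le_iff_ne_zero.mpr hs
  have hsC : (s : ℂ) ≠ 0 := by exact_mod_cast hs
  have h2F : (2 : F) ≠ 0 := Ring.two_ne_zero h2
  have hsneg : ∀ z : F, (-z) ^ s = -z ^ s := fun z => by
    have := hadd z (-z)
    rw [add_neg_cancel, zero_pow hs] at this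
    exact (neg_eq_of_add_eq_zero_right this.symm).symm
  set K : Finset F := {t : F | t ^ s = t} with hK
  have hKcard : #K = s := by
    rw [hK, card_filter_pow_eq_self_s12 hs1, hF, Nat.gcd_eq_right (Nat.sub_one_dvd_pow_sub_one s 2)]
    omega
  have hmem : ∀ t, t ∈ K ↔ t ^ s = t := by simp [hK]
  have hKadd : ∀ t ∈ K, ∀ u ∈ K, t + u ∈ K := fun t ht u hu => by
    rw [hmem] at *; rw [hadd, ht, hu]
  have hKneg : ∀ t ∈ K, -t ∈ K := fun t ht => by rw [hmem] at *; rw [hsneg, ht]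
  have hKmul : ∀ t ∈ K, ∀ u ∈ K, t * u ∈ K := fun t ht u hu => by
    rw [hmem] at *; rw [mul_pow, ht, hu]
  have hanti : ∀ v : F, v ^ s = -v → Ψ v = 1 := fun v hv => by
    have h2s : (2 : F) ^ s = 2 := by rw [← one_add_one_eq_two, hadd, one_pow]
    have hw : (v / 2) ^ s = -(v / 2) := by rw [div_pow, hv, h2s, neg_div]
    have h := hinv (v / 2)
    rw [hw] at h
    have hv2 : v = v / 2 + v / 2 := by field_simp; ring
    rw [hv2, AddChar.map_add_eq_mul]
    nth_rewrite 1 [← h]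
    rw [← AddChar.map_add_eq_mul, neg_add_cancel, AddChar.map_zero_eq_one]
  have hyK : ∀ t ∈ K, Ψ (y * t) = 1 := fun t ht => hanti _ (by
    rw [mul_pow, hy, (hmem t).mp ht, neg_mul])
  have hinner : ∀ x : F, ∑ t ∈ K, Ψ (2 * y * x * t) =
      if ∀ t ∈ K, Ψ (2 * y * x * t) = 1 then (s : ℂ) else 0 := fun x => by
    split_ifs with h
    · rw [sum_congr rfl h, sum_const, hKcard, nsmul_one]
    · push Not at h
      obtain ⟨u, hu, hu1⟩ := h
      have hshift : ∑ t ∈ K, Ψ (2 * y * x * t) = Ψ (2 * y * x * u) * ∑ t ∈ K, Ψ (2 * y * x * t) := by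
        rw [mul_sum]
        refine sum_bij' (fun t _ => t + -u) (fun t _ => t + u) (fun t ht => hKadd _ ht _ (hKneg u hu))
          (fun t ht => hKadd _ ht _ hu) (by simp) (by simp) fun t _ => ?_
        rw [← AddChar.map_add_eq_mul]
        congr 1; ring
      have h0 : (1 - Ψ (2 * y * x * u)) * ∑ t ∈ K, Ψ (2 * y * x * t) = 0 := by
        rw [sub_mul, one_mul, ← hshift, sub_self]
      exact (mul_eq_zero.mp h0).resolve_left (sub_ne_zero.mpr (Ne.symm hu1))
  have hperp : ({x : F | ∀ t ∈ K, Ψ (2 * y * x * t) = 1} : Finset F) = K := by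
    symm
    apply eq_of_subset_of_card_le
    · intro x hx
      simp only [mem_filter, mem_univ, true_and]
      intro t ht
      have h2K : (2 : F) ∈ K := by rw [hmem, ← one_add_one_eq_two, hadd, one_pow]
      rw [show 2 * y * x * t = y * (2 * x * t) by ring]
      exact hyK _ (hKmul _ (hKmul _ h2K _ hx) _ ht)
    · have hcount : ∑ x : F, ∑ t ∈ K, Ψ (2 * y * x * t) = (s : ℂ) * s := by
        rw [sum_comm]
        have : ∀ t : F, ∑ x : F, Ψ (2 * y * x * t) = if t = 0 then (s : ℂ) * s else 0 := fun t => by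
          have h := AddChar.sum_mulShift (2 * y * t) hΨ
          rw [hF] at h
          rw [sum_congr rfl fun x _ => show Ψ (2 * y * x * t) = Ψ (x * (2 * y * t)) by
            congr 1; ring, h]
          simp [h2F, hy0, sq]
        simp_rw [this]
        rw [sum_ite_eq', if_pos (by rw [hmem, zero_pow hs])]
      simp_rw [hinner] at hcount
      rw [← sum_filter, sum_const, nsmul_eq_mul] at hcount
      have := mul_right_cancel₀ hsC hcount
      rw [hKcard]
      exact le_of_eq (by exact_mod_cast this)
  have havg : (s : ℂ) * formSum Ψ 1 y = s * s := by
    have h1 : (s : ℂ) * formSum Ψ 1 y = ∑ t ∈ K, ∑ x : F, Ψ (y * (x + t) ^ 2) := by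
      rw [sum_congr rfl (g := fun _ => formSum Ψ 1 y) fun t _ =>
        Equiv.sum_comp (Equiv.addRight t) fun x => Ψ (y * x ^ 2), sum_const, hKcard, nsmul_eq_mul]
    rw [h1, sum_comm]
    have h3 : ∀ x : F, ∑ t ∈ K, Ψ (y * (x + t) ^ 2) =
        Ψ (y * x ^ 2) * ∑ t ∈ K, Ψ (2 * y * x * t) := fun x => by
      rw [mul_sum]
      refine sum_congr rfl fun t ht => ?_
      rw [show y * (x + t) ^ 2 = y * x ^ 2 + 2 * y * x * t + y * (t * t) by ring,
        AddChar.map_add_eq_mul, hyK _ (hKmul _ ht _ ht), mul_one, AddChar.map_add_eq_mul]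
    simp_rw [h3, hinner, mul_ite, mul_zero]
    rw [← sum_filter, hperp, sum_congr rfl (g := fun _ => (s : ℂ)) fun x hx => by
      rw [sq, hyK _ (hKmul _ hx _ hx), one_mul], sum_const, hKcard, nsmul_eq_mul]
  exact mul_left_cancel₀ hsC havg

theorem formSum_one_eq_quadraticChar_mul {F : Type*} [Field F] [Fintype F] [DecidableEq F]
    {Ψ : AddChar F ℂ} (hΨ : Ψ.IsPrimitive) (h2 : ringChar F ≠ 2) {a : F} (ha : a ≠ 0) :
    formSum Ψ 1 a = quadraticChar F a * ∑ z : F, (quadraticChar F z : ℂ) * Ψ z := by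
  have h1 : formSum Ψ 1 a = ∑ z : F, ((quadraticChar F z : ℂ) + 1) * Ψ (a * z) := by
    rw [formSum, ← sum_fiberwise (s := univ) (g := fun x : F => x ^ 2)]
    refine sum_congr rfl fun z _ => ?_
    have hc := quadraticChar_card_sqrts h2 z
    rw [Set.toFinset_ofPred] at hc
    have hc' : ((#{x : F | x ^ 2 = z} : ℕ) : ℂ) = (quadraticChar F z : ℂ) + 1 := by exact_mod_cast hc
    rw [sum_congr rfl (g := fun _ => Ψ (a * z)) fun x hx => by
      rw [one_add_one_eq_two, (mem_filter.mp hx).2], sum_const, nsmul_eq_mul, hc']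
  have h0 : ∑ z : F, Ψ (a * z) = 0 := by
    simp_rw [mul_comm a, AddChar.sum_mulShift a hΨ, if_neg ha, Nat.cast_zero]
  rw [h1]
  simp_rw [add_mul, one_mul]
  rw [sum_add_distrib, h0, add_zero, mul_sum,
    ← Equiv.sum_comp (Equiv.mulLeft₀ a ha)
      fun z => (quadraticChar F a : ℂ) * (quadraticChar F z * Ψ z)]
  refine sum_congr rfl fun z _ => ?_
  have hsq : (quadraticChar F a : ℂ) * quadraticChar F a = 1 := by
    have := quadraticChar_sq_one ha
    rw [sq] at this
    exact_mod_cast this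
  rw [Equiv.mulLeft₀_apply, map_mul (quadraticChar F)]
  push_cast
  linear_combination -(quadraticChar F z : ℂ) * Ψ (a * z) * hsq

theorem formSum_one_eq {F : Type*} [Field F] [Fintype F] [DecidableEq F]
    {Ψ : AddChar F ℂ} (hΨ : Ψ.IsPrimitive) (h2 : ringChar F ≠ 2) {s : ℕ} (hs : Odd s)
    (hF : Fintype.card F = s ^ 2) (hadd : ∀ x y : F, (x + y) ^ s = x ^ s + y ^ s)
    (hinv : ∀ z, Ψ (z ^ s) = Ψ z) {a : F} (ha : a ≠ 0) :
    formSum Ψ 1 a = ((quadraticChar F a * (-1) ^ ((s + 1) / 2) : ℤ) : ℂ) * s := by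
  obtain ⟨g, hg⟩ := FiniteField.exists_nonsquare h2
  have hg0 : g ≠ 0 := fun h => hg (h ▸ IsSquare.zero)
  obtain ⟨k, rfl⟩ := hs
  have hk : (2 * k + 1 + 1) / 2 = k + 1 := by omega
  have hgp : g ^ (2 * k * (k + 1)) = -1 := by
    have h := (FiniteField.pow_dichotomy h2 hg0).resolve_left fun h =>
      hg ((FiniteField.isSquare_iff h2 hg0).mpr h)
    rw [← h, hF]
    congr 1
    rw [show (2 * k + 1) ^ 2 = 2 * (2 * k * (k + 1)) + 1 by ring]
    omega
  have hy0 : g ^ (k + 1) ≠ 0 := pow_ne_zero _ hg0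
  have hy : (g ^ (k + 1)) ^ (2 * k + 1) = -g ^ (k + 1) := by
    rw [← neg_one_mul, ← hgp]; ring
  have hS := formSum_one_eq_of_pow_eq_neg hΨ h2 (by omega) hF hadd hinv hy0 hy
  rw [formSum_one_eq_quadraticChar_mul hΨ h2 hy0, map_pow,
    quadraticChar_neg_one_iff_not_isSquare.mpr hg] at hS
  rw [formSum_one_eq_quadraticChar_mul hΨ h2 ha, hk]
  have hsq : ((-1 : ℂ) ^ (k + 1)) * (-1) ^ (k + 1) = 1 := by rw [← mul_pow]; simp
  push_cast at hS ⊢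
  linear_combination (quadraticChar F a : ℂ) * (-1) ^ (k + 1) * hS -
    (quadraticChar F a : ℂ) * (∑ z : F, (quadraticChar F z : ℂ) * Ψ z) * hsq

theorem isSquare_of_pow_eq_self {F : Type*} [Field F] [Fintype F] (h2 : ringChar F ≠ 2) {q j : ℕ}
    (hF : Fintype.card F = (q ^ 2) ^ j) (hq : Odd q) {t : F} (ht0 : t ≠ 0) (ht : t ^ q = t) :
    IsSquare t := by
  rw [FiniteField.isSquare_iff h2 ht0]
  obtain ⟨k, rfl⟩ := hq
  obtain ⟨i, hi⟩ := Nat.sub_one_dvd_pow_sub_one ((2 * k + 1) ^ 2) j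
  have hodd := FiniteField.odd_card_of_char_ne_two h2
  have hsq : (2 * k + 1) ^ 2 - 1 = 2 * (2 * k * (k + 1)) := by
    rw [Nat.sub_eq_iff_eq_add (Nat.one_le_pow _ _ (by omega))]; ring
  rw [hsq, ← hF, mul_assoc 2] at hi
  have ht1 : t ^ (2 * k) = 1 := by
    rw [pow_succ] at ht
    exact mul_eq_right₀ ht0 |>.mp ht
  rw [show Fintype.card F / 2 = 2 * k * (k + 1) * i by omega, pow_mul, pow_mul, ht1, one_pow, one_pow]

theorem exists_pow_eq_self_not_isSquare {F : Type*} [Field F] [Fintype F] (h2 : ringChar F ≠ 2)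
    {q ℓ : ℕ} (hF : Fintype.card F = q ^ ℓ) (hq : Odd q) (hℓ : Odd ℓ) :
    ∃ t : F, t ≠ 0 ∧ t ^ q = t ∧ ¬IsSquare t := by
  classical
  obtain ⟨g, hg⟩ := FiniteField.exists_nonsquare h2
  have hg0 : g ≠ 0 := fun h => hg (h ▸ IsSquare.zero)
  have ht0 : ∏ i ∈ range ℓ, g ^ q ^ i ≠ 0 := prod_ne_zero_iff.mpr fun i _ => pow_ne_zero _ hg0
  refine ⟨_, ht0, ?_, ?_⟩
  · have h1 := prod_range_succ' (fun i => g ^ q ^ i) ℓ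
    rw [prod_range_succ, ← hF, FiniteField.pow_card, pow_zero, pow_one] at h1
    rw [← prod_pow, mul_right_cancel₀ hg0 h1]
    exact prod_congr rfl fun i _ => by rw [pow_succ, pow_mul]
  · rw [← quadraticChar_neg_one_iff_not_isSquare, map_prod]
    simp_rw [map_pow, quadraticChar_neg_one_iff_not_isSquare.mpr hg, (hq.pow).neg_one_pow]
    rw [prod_const, card_range, hℓ.neg_one_pow]

theorem norm_formSum_sq_le {F : Type*} [Field F] [Fintype F] [DecidableEq F] {Ψ : AddChar F ℂ}
    (hΨ : Ψ.IsPrimitive) {s : ℕ} (hs : s ≠ 0)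
    (hadd : ∀ x y : F, (x + y) ^ s = x ^ s + y ^ s) (hinv : ∀ z, Ψ (z ^ s) = Ψ z) (a : F) :
    ‖formSum Ψ s a‖ ^ 2 ≤
      Fintype.card F * #{x : F | a ^ s * (x ^ s) ^ s + a * x = 0} := by
  have h := congrArg norm (formSum_mul_conj hΨ hs hadd hinv a)
  rw [norm_mul, RCLike.norm_conj, norm_mul, Complex.norm_natCast, ← sq] at h
  rw [h]
  gcongr
  refine (norm_sum_le _ _).trans ?_
  simp [AddChar.norm_apply]

theorem sum_eq_card_mul_iff {ι : Type*} (A : Finset ι) (f : ι → ℂ) {M : ℝ}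
    (hf : ∀ i ∈ A, ‖f i‖ ≤ M) : ∑ i ∈ A, f i = #A * M ↔ ∀ i ∈ A, f i = M := by
  constructor
  · intro h
    have hre : ∑ i ∈ A, (f i).re = ∑ i ∈ A, M := by
      rw [← Complex.re_sum, h, sum_const, nsmul_eq_mul, ← Complex.ofReal_natCast,
        ← Complex.ofReal_mul, Complex.ofReal_re]
    have hle : ∀ i ∈ A, (f i).re ≤ M := fun i hi => (Complex.re_le_norm _).trans (hf i hi)
    intro i hi
    have h1 := (sum_eq_sum_iff_of_le hle).mp hre i hi
    have h2 : (f i).im = 0 := Complex.abs_re_eq_norm.mp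
      (le_antisymm (Complex.abs_re_le_norm _) ((hf i hi).trans (h1 ▸ le_abs_self _)))
    exact Complex.ext (by simpa using h1) (by simpa using h2)
  · intro h
    rw [sum_congr rfl h, sum_const, nsmul_eq_mul]

theorem card_radical_le {F : Type*} [Field F] [Fintype F] [DecidableEq F] {q ℓ r : ℕ} (hq : 2 ≤ q)
    (hr : 1 ≤ r) (hF : Fintype.card F = q ^ ℓ) {a : F} (ha : a ≠ 0) :
    #{x : F | a ^ q ^ r * (x ^ q ^ r) ^ q ^ r + a * x = 0} ≤ q ^ (2 * r) := by
  by_cases h : ∃ x₁ : F, x₁ ≠ 0 ∧ a ^ q ^ r * (x₁ ^ q ^ r) ^ q ^ r + a * x₁ = 0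
  · obtain ⟨x₁, hx₁, h⟩ := h
    rw [card_radical hq hF ha hx₁ h]
    exact Nat.pow_le_pow_right (by omega) (Nat.gcd_le_left _ (by omega))
  · push Not at h
    refine le_trans (card_le_card (t := {0}) fun x hx => ?_) ?_
    · rw [mem_singleton]
      by_contra hx0
      exact h x hx0 (mem_filter.mp hx).2
    · exact (card_singleton (0 : F)).le.trans (Nat.one_le_pow _ _ (by omega))

theorem card_solutions_eq_iff {F : Type*} [Field F] [Fintype F] [DecidableEq F] {Ψ : AddChar F ℂ}
    (hΨ : Ψ.IsPrimitive) {q ℓ r M : ℕ} (hq : 2 ≤ q) (hF : Fintype.card F = q ^ ℓ)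
    (hadd : ∀ (i : ℕ) (x y : F), (x + y) ^ q ^ i = x ^ q ^ i + y ^ q ^ i)
    (hΨT : ∀ z : F, ∑ i ∈ range ℓ, z ^ q ^ i = 0 → Ψ z = 1)
    (hinv : ∀ (i : ℕ) (z : F), Ψ (z ^ q ^ i) = Ψ z) {a b c x₀ : F}
    (hx₀ : a ^ q ^ r * x₀ ^ q ^ (2 * r) + a * x₀ = -(b ^ q ^ r))
    (hT : ∑ i ∈ range ℓ, (a * x₀ ^ (q ^ r + 1) - c) ^ q ^ i = 0)
    (hM : ∀ t : F, t ≠ 0 → t ^ q = t → ‖formSum Ψ (q ^ r) (t * a)‖ ≤ M) :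
    Nat.card {xy : F × F // xy.2 ^ q - xy.2 = a * xy.1 ^ (q ^ r + 1) + b * xy.1 + c} =
        q ^ ℓ + (q - 1) * M ↔
      ∀ t : F, t ≠ 0 → t ^ q = t → formSum Ψ (q ^ r) (t * a) = M := by
  let T : F →+ F := AddMonoidHom.mk' (fun z => ∑ i ∈ range ℓ, z ^ q ^ i) fun x y => by
    simp_rw [hadd, sum_add_distrib]
  have hlin : ∀ t : F, t ^ q = t → ∀ z, T (t * z) = t * T z := by
    intro t ht z
    have hti : ∀ i : ℕ, t ^ q ^ i = t := fun i => by
      induction i with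
      | zero => simp
      | succ i ih => rw [pow_succ, pow_mul, ih, ht]
    simp only [T, AddMonoidHom.mk'_apply, mul_pow, hti, mul_sum]
  have hsum := card_solutions_eq_sum hΨ (q := q) (by omega) (fun x y => by simpa using hadd 1 x y)
    (fun z => by simpa using hinv 1 z) fun x => a * x ^ (q ^ r + 1) + b * x + c
  have hshift : ∀ t ∈ ({t : F | t ^ q = t} : Finset F),
      ∑ x : F, Ψ (t * (a * x ^ (q ^ r + 1) + b * x + c)) = formSum Ψ (q ^ r) (t * a) :=
    fun t ht => sum_addChar_shift T (hadd r) (fun z => sum_pow_frobenius hF r z) hΨT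
      (hlin t (mem_filter.mp ht).2)
      (by rw [← pow_mul, ← pow_add, ← two_mul]; exact hx₀) hT
  have h0mem : (0 : F) ∈ ({t : F | t ^ q = t} : Finset F) := by
    simp [show q ≠ 0 by omega]
  have hLcard : #({t : F | t ^ q = t} : Finset F) = q := by
    rw [card_filter_pow_eq_self_s12 (k := q) (by omega), hF,
      Nat.gcd_eq_right (Nat.sub_one_dvd_pow_sub_one q ℓ)]
    omega
  have hzero : formSum Ψ (q ^ r) (0 * a) = (q ^ ℓ : ℕ) := by
    simp [formSum, hF]
  rw [sum_congr rfl hshift, ← add_sum_erase _ _ h0mem, hzero] at hsum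
  have hcardE : #(({t : F | t ^ q = t} : Finset F).erase 0) = q - 1 := by
    rw [card_erase_of_mem h0mem, hLcard]
  have hmemE : ∀ t : F, t ∈ ({t : F | t ^ q = t} : Finset F).erase 0 ↔ t ≠ 0 ∧ t ^ q = t := by
    simp
  have hiff := sum_eq_card_mul_iff (({t : F | t ^ q = t} : Finset F).erase 0)
    (fun t => formSum Ψ (q ^ r) (t * a)) (M := M)
    fun t ht => hM t ((hmemE t).mp ht).1 ((hmemE t).mp ht).2
  rw [hcardE] at hiff
  simp only [hmemE, and_imp, Complex.ofReal_natCast] at hiff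
  rw [← hiff, ← Nat.cast_inj (R := ℂ), hsum]
  push_cast
  rw [add_right_inj]

theorem formSum_eq_iff_of_one_le {F : Type*} [Field F] [Fintype F] {Ψ : AddChar F ℂ}
    (hΨ : Ψ.IsPrimitive) {q ℓ r M : ℕ} (hq : 2 ≤ q) (hr : 1 ≤ r) (hF : Fintype.card F = q ^ ℓ)
    (hadd : ∀ (i : ℕ) (x y : F), (x + y) ^ q ^ i = x ^ q ^ i + y ^ q ^ i)
    (hΨT : ∀ z : F, ∑ i ∈ range ℓ, z ^ q ^ i = 0 → Ψ z = 1)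
    (hinv : ∀ (i : ℕ) (z : F), Ψ (z ^ q ^ i) = Ψ z) {a : F} (ha : a ≠ 0)
    (hM : M ^ 2 = q ^ ℓ * q ^ (2 * r)) :
    (∀ t : F, t ≠ 0 → t ^ q = t → formSum Ψ (q ^ r) (t * a) = M) ↔
      (2 * r) ∣ ℓ ∧ Odd (ℓ / (2 * r)) ∧
        ¬Function.Bijective (fun x : F => a ^ q ^ r * x ^ q ^ (2 * r) + a * x) := by
  classical
  have hpp : ∀ x : F, (x ^ q ^ r) ^ q ^ r = x ^ q ^ (2 * r) := fun x => by
    rw [← pow_mul, ← pow_add, two_mul]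
  have hs : 2 ≤ q ^ r := hq.trans (Nat.le_self_pow (by omega) q)
  have hneg : ∀ i, ∀ z : F, (-z) ^ q ^ i = -z ^ q ^ i := fun i z => by
    have := hadd i z (-z)
    rw [add_neg_cancel, zero_pow (pow_pos (by omega) i).ne'] at this
    exact (neg_eq_of_add_eq_zero_right this.symm).symm
  have hval : ∀ m : ℕ, ℓ = 2 * r * m → ∀ b x₁ : F, b ≠ 0 → x₁ ≠ 0 →
      b ^ q ^ r * (x₁ ^ q ^ r) ^ q ^ r + b * x₁ = 0 →
      formSum Ψ (q ^ r) b = (-1) ^ (m + 1) * M := by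
    intro m hm b x₁ hb hx₁ hker
    have hMm : M = (q ^ r) ^ (m + 1) := by
      refine Nat.pow_left_injective two_ne_zero ?_
      simp only [hM, hm]
      ring
    rw [hMm, Nat.cast_pow]
    refine formSum_eq_of_radical hΨ hs (by rw [hF, hm]; ring) (hadd r) (hinv r) ?_ ?_
    · rw [card_radical hq hF hb hx₁ hker, hm, Nat.gcd_mul_right_right]
      ring
    · intro x hx
      apply hΨT
      rw [hm]
      refine sum_pow_eq_zero_of_pow_eq_neg (r := r) ?_ hneg
      rw [mul_pow, pow_succ, mul_pow]
      linear_combination x ^ q ^ r * hx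
  have hMC : (M : ℂ) ≠ 0 := by
    rw [Nat.cast_ne_zero]
    rintro rfl
    have : 0 < q ^ ℓ * q ^ (2 * r) := by positivity
    omega
  have hqr : ∀ t : F, t ^ q = t → t ^ q ^ r = t := fun t ht => by
    clear hval hMC hM hs hpp hr
    induction r with
    | zero => simp
    | succ i ih => rw [pow_succ, pow_mul, ih, ht]
  constructor
  · intro h
    have hSa : formSum Ψ (q ^ r) a = M := by simpa using h 1 one_ne_zero (one_pow q)
    have hle := norm_formSum_sq_le hΨ (by omega) (hadd r) (hinv r) a
    rw [hSa, Complex.norm_natCast, hF] at hle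
    have hle' : q ^ (2 * r) ≤ #{x : F | a ^ q ^ r * (x ^ q ^ r) ^ q ^ r + a * x = 0} := by
      have h1 : M ^ 2 ≤ q ^ ℓ * #{x : F | a ^ q ^ r * (x ^ q ^ r) ^ q ^ r + a * x = 0} := by
        exact_mod_cast hle
      rw [hM] at h1
      exact Nat.le_of_mul_le_mul_left h1 (by positivity)
    have h1lt : 1 < #{x : F | a ^ q ^ r * (x ^ q ^ r) ^ q ^ r + a * x = 0} :=
      (Nat.one_lt_pow (by omega) (by omega)).trans_le hle'
    obtain ⟨x₁, hx₁W, hx₁⟩ := exists_mem_ne h1lt 0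
    have hker := (mem_filter.mp hx₁W).2
    rw [card_radical hq hF ha hx₁ hker] at hle'
    have hgcd : 2 * r ≤ (2 * r).gcd ℓ := (Nat.pow_le_pow_iff_right (by omega)).mp hle'
    have hdvd : 2 * r ∣ ℓ := by
      rw [← le_antisymm (Nat.gcd_le_left ℓ (by omega)) hgcd]
      exact Nat.gcd_dvd_right _ _
    refine ⟨hdvd, ?_, fun hbij => hx₁ (hbij.1 ?_)⟩
    · have hv := hval (ℓ / (2 * r)) (Nat.mul_div_cancel' hdvd).symm a x₁ ha hx₁ hker
      rw [hSa] at hv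
      have h1 : ((-1 : ℂ)) ^ (ℓ / (2 * r) + 1) = 1 := (mul_eq_right₀ hMC).mp hv.symm
      have h2 := (neg_one_pow_eq_one_iff_even (by norm_num)).mp h1
      exact Nat.not_even_iff_odd.mp fun h3 => (Nat.even_add_one.mp h2) h3
    · simp only
      rw [← hpp, hker, zero_pow (by positivity)]
      simp
  · rintro ⟨⟨m, hm⟩, hodd, hbij⟩ t ht0 ht
    rw [hm, Nat.mul_div_cancel_left _ (by omega)] at hodd
    have hninj : ¬Function.Injective (fun x : F => a ^ q ^ r * x ^ q ^ (2 * r) + a * x) :=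
      fun h => hbij (Finite.injective_iff_bijective.mp h)
    simp only [Function.Injective, not_forall] at hninj
    obtain ⟨x, y, hxy, hne⟩ := hninj
    have hker : (t * a) ^ q ^ r * ((x - y) ^ q ^ r) ^ q ^ r + (t * a) * (x - y) = 0 := by
      rw [hpp, mul_pow, hqr t ht, sub_eq_add_neg, hadd, hneg]
      linear_combination t * hxy
    rw [hval m hm _ _ (mul_ne_zero ht0 ha) (sub_ne_zero.mpr hne) hker, (hodd.add_one).neg_one_pow,
      one_mul]

theorem formSum_eq_iff_of_odd {F : Type*} [Field F] [Fintype F] {Ψ : AddChar F ℂ}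
    (hΨ : Ψ.IsPrimitive) {p n q ℓ k : ℕ} (hq : q = p ^ n) (hp2 : Odd p) (h2 : ringChar F ≠ 2)
    (hk : n * ℓ = 2 * k) (hF : Fintype.card F = q ^ ℓ)
    (hadd : ∀ x y : F, (x + y) ^ p ^ k = x ^ p ^ k + y ^ p ^ k)
    (hinv : ∀ z : F, Ψ (z ^ p ^ k) = Ψ z) {a : F} (ha : a ≠ 0) :
    (∀ t : F, t ≠ 0 → t ^ q = t → formSum Ψ 1 (t * a) = (p ^ k : ℕ)) ↔
      (Even ℓ ∧ p % 4 = 1 ∧ ¬IsSquare a) ∨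
        (Even ℓ ∧ p % 4 = 3 ∧ ((Odd k ∧ IsSquare a) ∨ (Even k ∧ ¬IsSquare a))) := by
  classical
  have hcard : Fintype.card F = (p ^ k) ^ 2 := by
    rw [hF, hq, ← pow_mul, ← pow_mul, hk, mul_comm]
  have hqo : Odd q := hq ▸ hp2.pow
  have hsC : ((p ^ k : ℕ) : ℂ) ≠ 0 := by exact_mod_cast (hp2.pow).pos.ne'
  have hS : ∀ t : F, t ≠ 0 → (formSum Ψ 1 (t * a) = (p ^ k : ℕ) ↔
      quadraticChar F t * quadraticChar F a * (-1) ^ ((p ^ k + 1) / 2) = 1) := fun t ht => by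
    rw [formSum_one_eq hΨ h2 hp2.pow hcard hadd hinv (mul_ne_zero ht ha), mul_eq_right₀ hsC,
      map_mul]
    exact_mod_cast Iff.rfl
  have ha1 : IsSquare a ↔ quadraticChar F a = 1 := (quadraticChar_one_iff_isSquare ha).symm
  have ha2 : ¬IsSquare a ↔ quadraticChar F a = -1 := quadraticChar_neg_one_iff_not_isSquare.symm
  rcases Nat.even_or_odd ℓ with hℓ | hℓ
  · have hall : (∀ t : F, t ≠ 0 → t ^ q = t → formSum Ψ 1 (t * a) = (p ^ k : ℕ)) ↔
        quadraticChar F a * (-1) ^ ((p ^ k + 1) / 2) = 1 := by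
      constructor
      · intro h
        simpa using (hS 1 one_ne_zero).mp (h 1 one_ne_zero (one_pow q))
      · intro h t ht0 ht
        obtain ⟨j, hj⟩ := hℓ
        rw [hS t ht0, (quadraticChar_one_iff_isSquare ht0).mpr
          (isSquare_of_pow_eq_self h2 (j := j) (by rw [hF, hj, ← two_mul, pow_mul]) hqo ht0 ht),
          one_mul, h]
    rw [hall]
    have hp4 : p % 4 = 1 ∨ p % 4 = 3 := by
      have := Nat.odd_iff.mp hp2
      omega
    have hε1 : (p ^ k) % 4 = 1 → (-1 : ℤ) ^ ((p ^ k + 1) / 2) = -1 := fun h =>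
      Odd.neg_one_pow (Nat.odd_iff.mpr (by omega))
    have hε3 : (p ^ k) % 4 = 3 → (-1 : ℤ) ^ ((p ^ k + 1) / 2) = 1 := fun h =>
      Even.neg_one_pow (Nat.even_iff.mpr (by omega))
    rcases hp4 with h4 | h4
    · rw [hε1 (by simp [Nat.pow_mod, h4])]
      simp [hℓ, h4, ha2, neg_eq_iff_eq_neg]
    · rcases Nat.even_or_odd k with hke | hko
      · have : p ^ k % 4 = 1 := by
          obtain ⟨j, rfl⟩ := hke
          rw [← two_mul, pow_mul, Nat.pow_mod, Nat.pow_mod p, h4]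
          simp
        rw [hε1 this]
        simp [hℓ, h4, ha2, neg_eq_iff_eq_neg, hke]
      · have : p ^ k % 4 = 3 := by
          obtain ⟨j, rfl⟩ := hko
          rw [pow_succ, pow_mul, Nat.mul_mod, Nat.pow_mod, Nat.pow_mod p, h4]
          simp
        rw [hε3 this]
        simp [hℓ, h4, ha1, hko, Nat.not_even_iff_odd.mpr hko]
  · obtain ⟨t, ht0, ht, hns⟩ := exists_pow_eq_self_not_isSquare h2 hF hqo hℓ
    have hℓ' := Nat.not_even_iff_odd.mpr hℓ
    simp only [hℓ', false_and, or_self, iff_false]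
    intro h
    have h1 := (hS 1 one_ne_zero).mp (h 1 one_ne_zero (one_pow q))
    have h3 := (hS t ht0).mp (h t ht0 ht)
    rw [quadraticChar_neg_one_iff_not_isSquare.mpr hns] at h3
    rw [map_one] at h1
    linarith

theorem formSum_one_eq_zero_of_char_two {F : Type*} [Field F] [Fintype F] [CharP F 2]
    {Ψ : AddChar F ℂ} (hΨ : Ψ.IsPrimitive) {a : F} (ha : a ≠ 0) : formSum Ψ 1 a = 0 := by
  classical
  have hbij : Function.Bijective fun x : F => x ^ 2 :=
    Finite.injective_iff_bijective.mp (frobenius_inj F 2)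
  rw [formSum, one_add_one_eq_two, hbij.sum_comp (fun y => Ψ (a * y))]
  simp_rw [mul_comm a, AddChar.sum_mulShift a hΨ, if_neg ha, Nat.cast_zero]

theorem norm_formSum_one_le {F : Type*} [Field F] [Fintype F] {Ψ : AddChar F ℂ}
    (hΨ : Ψ.IsPrimitive) (h2 : ringChar F ≠ 2) {s : ℕ} (hs : Odd s)
    (hF : Fintype.card F = s ^ 2) (hadd : ∀ x y : F, (x + y) ^ s = x ^ s + y ^ s)
    (hinv : ∀ z, Ψ (z ^ s) = Ψ z) {a : F} (ha : a ≠ 0) : ‖formSum Ψ 1 a‖ ≤ s := by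
  classical
  rw [formSum_one_eq hΨ h2 hs hF hadd hinv ha]
  rcases quadraticChar_dichotomy ha with h | h <;> simp [h]

end

/-- Let `p` be prime, `q = p ^ n`, `ℓ ≥ 2`, `r ≥ 0` with `nℓ` even.
Let `a, b, c ∈ F_{q^ℓ}` with `a ≠ 0`, `f(x) = a^(q^r) x^(q^(2r)) + a x`, and suppose there
is `x₀` with `f(x₀) = -b^(q^r)` and `T(a x₀^(q^r+1) - c) = 0`.  Then
`N_{ℓ,r}(a,b,c) = q^ℓ + (q-1) p^(nℓ/2 + nr)` (maximality) iff one of the conditions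
(1), (2), (3) of Theorem `max` holds. -/
theorem stmt_12 (p n : ℕ) (hp : p.Prime) (hn : 1 ≤ n) (q : ℕ) (hq : q = p ^ n)
    (ℓ r : ℕ) (hℓ : 2 ≤ ℓ) (hnl : Even (n * ℓ))
    (F : Type) [Field F] [Fintype F] (hF : Fintype.card F = q ^ ℓ)
    (T : F → F) (hT : ∀ z : F, T z = ∑ i ∈ Finset.range ℓ, z ^ q ^ i)
    (a b c : F) (ha : a ≠ 0)
    (hsol : ∃ x₀ : F, a ^ q ^ r * x₀ ^ q ^ (2 * r) + a * x₀ = -(b ^ q ^ r) ∧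
      T (a * x₀ ^ (q ^ r + 1) - c) = 0) :
    (Nat.card {xy : F × F //
        xy.2 ^ q - xy.2 = a * xy.1 ^ (q ^ r + 1) + b * xy.1 + c}
      = q ^ ℓ + (q - 1) * p ^ (n * ℓ / 2 + n * r))
    ↔ ((r = 0 ∧ Even ℓ ∧ p % 4 = 1 ∧ ¬IsSquare a) ∨
       (r = 0 ∧ Even ℓ ∧ p % 4 = 3 ∧
         ((Odd (n * ℓ / 2) ∧ IsSquare a) ∨ (Even (n * ℓ / 2) ∧ ¬IsSquare a))) ∨
       (1 ≤ r ∧ (2 * r) ∣ ℓ ∧ Odd (ℓ / (2 * r)) ∧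
         ¬Function.Bijective (fun x : F => a ^ q ^ r * x ^ q ^ (2 * r) + a * x))) := by

  classical
  have : Fact p.Prime := ⟨hp⟩
  have hFp : Fintype.card F = p ^ (n * ℓ) := by rw [hF, hq, ← pow_mul]
  have : CharP F p := charP_of_card_eq_prime_pow hFp
  have hringChar : ringChar F = p := ringChar.eq F p ▸ rfl
  have hq2 : 2 ≤ q := hq ▸ hp.two_le.trans (Nat.le_self_pow (by omega) p)
  obtain ⟨k, hk⟩ := hnl
  rw [← two_mul] at hk
  have hk2 : n * ℓ / 2 = k := by omega
  have haddp : ∀ (i : ℕ) (x y : F), (x + y) ^ p ^ i = x ^ p ^ i + y ^ p ^ i :=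
    fun i x y => add_pow_char_pow x y p i
  have hadd : ∀ (i : ℕ) (x y : F), (x + y) ^ q ^ i = x ^ q ^ i + y ^ q ^ i := fun i x y => by
    rw [hq, ← pow_mul, haddp]
  obtain ⟨Ψ, hΨ, hΨT, hΨp⟩ :=
    exists_primitive_addChar_eq_one_of_trace_eq_zero hp (hF.trans (by rw [hq]))
  rw [← hq] at hΨT
  have hinvp : ∀ (i : ℕ) (z : F), Ψ (z ^ p ^ i) = Ψ z := fun i z => by
    induction i with
    | zero => simp
    | succ i ih => rw [pow_succ, pow_mul, hΨp, ih]
  have hinv : ∀ (i : ℕ) (z : F), Ψ (z ^ q ^ i) = Ψ z := fun i z => by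
    rw [hq, ← pow_mul, hinvp]
  obtain ⟨x₀, hx₀, hTx₀⟩ := hsol
  rw [hT] at hTx₀
  have hMsq : (p ^ (k + n * r)) ^ 2 = q ^ ℓ * q ^ (2 * r) := by
    rw [← pow_add, hq, ← pow_mul, ← pow_mul]
    congr 1
    linear_combination -hk
  rw [hk2]
  rcases Nat.eq_zero_or_pos r with rfl | hr
  · simp only [show ¬1 ≤ 0 by omega, false_and, or_false, true_and, mul_zero, add_zero]
    have key := card_solutions_eq_iff (M := p ^ k) hΨ hq2 hF hadd hΨT hinv hx₀ hTx₀
    rw [pow_zero] at key ⊢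
    have hp0 : ((p ^ k : ℕ) : ℂ) ≠ 0 := by exact_mod_cast (pow_pos hp.pos k).ne'
    rcases hp.eq_two_or_odd' with h2 | hodd
    · have : CharP F 2 := h2 ▸ ‹CharP F p›
      have hzero : ∀ t : F, t ≠ 0 → formSum Ψ 1 (t * a) = 0 := fun t ht =>
        formSum_one_eq_zero_of_char_two hΨ (mul_ne_zero ht ha)
      rw [key fun t ht _ => by rw [hzero t ht, norm_zero]; positivity]
      simp only [h2, show ¬2 % 4 = 1 by norm_num, show ¬2 % 4 = 3 by norm_num, false_and, and_false,
        or_self, iff_false]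
      intro h
      have h1 := h 1 one_ne_zero (one_pow q)
      rw [hzero 1 one_ne_zero, ← h2] at h1
      exact hp0 h1.symm
    · have hr2 : ringChar F ≠ 2 := by
        rw [hringChar]
        rintro rfl
        exact absurd hodd (by decide)
      have hcard : Fintype.card F = (p ^ k) ^ 2 := by rw [hFp, hk, ← pow_mul, mul_comm]
      rw [key fun t ht _ => norm_formSum_one_le hΨ hr2 hodd.pow hcard (haddp k) (hinvp k)
        (mul_ne_zero ht ha)]
      exact formSum_eq_iff_of_odd hΨ hq hodd hr2 hk hF (haddp k) (hinvp k) ha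
  · have hr0 : r ≠ 0 := by omega
    simp only [hr0, false_and, false_or, show 1 ≤ r from hr, true_and]
    rw [card_solutions_eq_iff hΨ hq2 hF hadd hΨT hinv hx₀ hTx₀ fun t ht _ => ?_]
    · exact formSum_eq_iff_of_one_le hΨ hq2 hr hF hadd hΨT hinv ha hMsq
    · have hle := norm_formSum_sq_le hΨ (pow_pos (by omega) r).ne' (hadd r) (hinv r) (t * a)
      have hW := card_radical_le hq2 hr hF (mul_ne_zero ht ha)
      rw [← pow_le_pow_iff_left₀ (norm_nonneg _) (Nat.cast_nonneg _) two_ne_zero]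
      refine hle.trans ?_
      rw [hF]
      exact_mod_cast (Nat.mul_le_mul_left _ hW).trans hMsq.ge
end

section
/- Let p > 2 be a prime, q = p^n, and let ℓ ≥ 3 be odd; set r = (ℓ+1)/2. Then the pointset K = {(x : y : 1) : x, y ∈ F_{q^ℓ}, T(y) = T(x^{q^r+1})} ∪ {(0:1:0)} is a complete (N, d)-arc in PG(2, q^ℓ) with N = q^{2ℓ−1} + 1 and d = q^{ℓ−1} + q^{r−1}; that is, #K = q^{2ℓ−1} + 1, every line of PG(2, q^ℓ) contains at most q^{ℓ−1} + q^{r−1} points of K, and for every point P ∉ K there is a line through P containing exactly q^{ℓ−1} + q^{r−1} points of K. -/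
open Finset

section count
variable {k : Type*} [Field k] [Fintype k] [DecidableEq k]

theorem sum_addChar_mul_sq {R : Type*} [CommRing R] [IsDomain R] (hk : ringChar k ≠ 2)
    {ψ : AddChar k R} (hψ : ψ.IsPrimitive) {a : k} (ha : a ≠ 0) :
    ∑ x, ψ (a * (x * x)) = (quadraticChar k a : R) *
      gaussSum ((quadraticChar k).ringHomComp (Int.castRingHom R)) ψ := by
  have h1 : ∑ x, ψ (a * (x * x)) = ∑ y, ((quadraticChar k y : ℤ) + 1 : R) * ψ (a * y) := by
    rw [← Finset.sum_fiberwise (s := univ) (g := fun x : k => x * x)]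
    refine Finset.sum_congr rfl fun y _ => ?_
    have h2 := quadraticChar_card_sqrts hk y
    have h3 : ({x : k | x ^ 2 = y}.toFinset) = univ.filter fun x => x * x = y := by
      ext x; simp [sq]
    rw [h3] at h2
    rw [Finset.sum_congr rfl (g := fun _ => ψ (a * y))]
    · rw [Finset.sum_const, nsmul_eq_mul]
      congr 1
      exact_mod_cast congrArg (Int.cast : ℤ → R) h2
    · intro x hx
      simp only [mem_filter] at hx
      rw [hx.2]
  have h4 : ∑ y, ψ (a * y) = 0 := by
    have := AddChar.sum_mulShift a hψ
    simpa [ha, mul_comm] using this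
  have h5 := gaussSum_mulShift ((quadraticChar k).ringHomComp (Int.castRingHom R)) ψ (Units.mk0 a ha)
  have h6 : ((quadraticChar k a : ℤ) : R) * (quadraticChar k a : ℤ) = 1 := by
    have := quadraticChar_sq_one ha
    rw [sq] at this
    exact_mod_cast congrArg (Int.cast : ℤ → R) this
  rw [h1, ← h5]
  simp only [add_mul, one_mul, Finset.sum_add_distrib, h4, add_zero]
  simp only [MulChar.ringHomComp_apply, Units.val_mk0, eq_intCast, gaussSum, AddChar.mulShift_apply]
  rw [← mul_assoc, h6, one_mul]

theorem card_sum_mul_sq_eq (hk : ringChar k ≠ 2) (m : ℕ) (w : Fin (2 * m + 1) → kˣ) :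
    ∃ u : k, u ≠ 0 ∧ ∀ c : k,
      (#{x : Fin (2 * m + 1) → k | ∑ i, (w i : k) * (x i * x i) = c} : ℤ) =
        (Fintype.card k : ℤ) ^ (2 * m) + quadraticChar k (u * c) * (Fintype.card k : ℤ) ^ m := by
  have hchar : ringChar ℚ ≠ ringChar k := by
    rw [ringChar.eq_zero]
    exact fun h => CharP.ringChar_ne_zero_of_finite k h.symm
  let Ψ := AddChar.FiniteField.primitiveChar k ℚ hchar
  let R := CyclotomicField Ψ.n ℚ
  let ψ : AddChar k R := Ψ.char
  have hψ : ψ.IsPrimitive := Ψ.prim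
  let χ := (quadraticChar k).ringHomComp (Int.castRingHom R)
  have hχa : ∀ a, χ a = ((quadraticChar k a : ℤ) : R) := fun a => by
    simp [χ, MulChar.ringHomComp_apply]
  let g := gaussSum χ ψ
  have hχq : χ.IsQuadratic := (quadraticChar_isQuadratic k).comp _
  have hχ1 : χ ≠ 1 := by
    obtain ⟨a, ha⟩ := quadraticChar_exists_neg_one' hk
    intro h
    have h2 := hχa a
    rw [h, ha, MulChar.one_apply_coe] at h2
    norm_num at h2
  have hg : g ^ 2 = χ (-1) * (Fintype.card k : R) := gaussSum_sq hχ1 hχq hψ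
  have hk0 : (Fintype.card k : R) ≠ 0 := Nat.cast_ne_zero.2 Fintype.card_ne_zero
  let D : k := ∏ i, (w i : k)
  have hD : D ≠ 0 := Finset.prod_ne_zero_iff.2 fun i _ => (w i).ne_zero
  have hG : ∀ t : k, ∑ x : Fin (2 * m + 1) → k, ψ (t * ∑ i, (w i : k) * (x i * x i)) =
      ∏ i, ∑ y, ψ (t * w i * (y * y)) := fun t => by
    rw [Finset.prod_univ_sum, Fintype.piFinset_univ]
    refine Finset.sum_congr rfl fun x _ => ?_
    simp only [Finset.mul_sum, ← mul_assoc]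
    exact map_prod ψ.toMonoidHom (fun i => Multiplicative.ofAdd (t * w i * x i * x i)) univ
  have hG0 : ∀ t : k, t ≠ 0 → ∏ i, ∑ y, ψ (t * w i * (y * y)) =
      χ t * χ D * g ^ (2 * m + 1) := fun t ht => by
    have : ∀ i, ∑ y, ψ (t * w i * (y * y)) = χ t * χ (w i) * g := fun i => by
      rw [sum_addChar_mul_sq hk hψ (mul_ne_zero ht (w i).ne_zero), ← hχa, map_mul]
    simp only [this, Finset.prod_mul_distrib, Finset.prod_const, card_univ, Fintype.card_fin, D,
      map_prod]
    congr 2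
    have ht2 : χ t ^ 2 = 1 := by
      rw [hχa]
      exact_mod_cast congrArg (Int.cast : ℤ → R) (quadraticChar_sq_one ht)
    rw [pow_succ, pow_mul, ht2, one_pow, one_mul]
  refine ⟨(-1) ^ m * D, mul_ne_zero (by simp) hD, fun c => ?_⟩
  have key : (Fintype.card k : R) * #{x : Fin (2 * m + 1) → k | ∑ i, (w i : k) * (x i * x i) = c} =
      (Fintype.card k : R) ^ (2 * m + 1) + χ D * g ^ (2 * m + 1) * (χ (-c) * g) := by
    have e1 : (Fintype.card k : R) * #{x : Fin (2 * m + 1) → k | ∑ i, (w i : k) * (x i * x i) = c} =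
        ∑ x : Fin (2 * m + 1) → k, ∑ t, ψ (t * (∑ i, (w i : k) * (x i * x i) - c)) := by
      simp only [AddChar.sum_mulShift _ hψ, sub_eq_zero]
      rw [Finset.card_filter, Nat.cast_sum, Finset.mul_sum]
      refine Finset.sum_congr rfl fun x _ => ?_
      split_ifs <;> simp
    rw [e1, Finset.sum_comm]
    have e2 : ∀ t, ∑ x : Fin (2 * m + 1) → k, ψ (t * (∑ i, (w i : k) * (x i * x i) - c)) =
        ψ (-c * t) * ∏ i, ∑ y, ψ (t * w i * (y * y)) := fun t => by
      rw [← hG, Finset.mul_sum]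
      refine Finset.sum_congr rfl fun x _ => ?_
      rw [← AddChar.map_add_eq_mul]
      ring_nf
    have e3 : ∀ t, ψ (-c * t) * ∏ i, ∑ y, ψ (t * w i * (y * y)) =
        (if t = 0 then (Fintype.card k : R) ^ (2 * m + 1) else 0) +
        χ D * g ^ (2 * m + 1) * (χ t * ψ (-c * t)) := fun t => by
      split_ifs with ht
      · subst ht; simp [hχa]
      · rw [hG0 t ht]; ring
    simp only [e2, e3, Finset.sum_add_distrib, ← Finset.mul_sum]
    simp only [sum_ite_eq', mem_univ, if_true]
    congr 2
    by_cases hc : c = 0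
    · subst hc
      simp only [neg_zero, zero_mul, AddChar.map_zero_eq_one, mul_one,
        MulChar.sum_eq_zero_of_ne_one hχ1, MulChar.map_zero]
    · have := gaussSum_mulShift_eq χ ψ (Units.mk0 (-c) (neg_ne_zero.2 hc))
      rw [hχq.inv] at this
      exact this
  have e4 : g ^ (2 * m + 1) * g = (χ (-1) * (Fintype.card k : R)) ^ (m + 1) := by
    rw [← hg, ← pow_mul, ← pow_succ]; ring
  have hone : χ (-1) * χ (-1) = 1 := by rw [← map_mul]; simp
  have e5 : (Fintype.card k : R) * #{x : Fin (2 * m + 1) → k | ∑ i, (w i : k) * (x i * x i) = c} =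
      (Fintype.card k : R) * ((Fintype.card k : R) ^ (2 * m) +
        χ ((-1) ^ m * D * c) * (Fintype.card k : R) ^ m) := by
    rw [key]
    have : χ (-c) = χ (-1) * χ c := by rw [← map_mul]; simp
    rw [this, map_mul, map_mul, map_pow]
    calc _ = (Fintype.card k : R) ^ (2 * m + 1) + χ D * χ (-1) * χ c * (g ^ (2 * m + 1) * g) := by
          ring
      _ = (Fintype.card k : R) ^ (2 * m + 1) + χ D * (χ (-1) * χ (-1)) * χ c * χ (-1) ^ m *
            (Fintype.card k : R) ^ (m + 1) := by rw [e4]; ring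
      _ = _ := by rw [hone]; ring
  have e6 := mul_left_cancel₀ hk0 e5
  rw [hχa] at e6
  apply Int.cast_injective (α := R)
  rw [Int.cast_add, Int.cast_mul, Int.cast_pow, Int.cast_pow, Int.cast_natCast, Int.cast_natCast]
  exact e6

theorem QuadraticForm.card_eq_of_odd_finrank {V : Type*} [AddCommGroup V] [Module k V] [Fintype V]
    (hk : ringChar k ≠ 2) [Invertible (2 : k)] (Q : QuadraticForm k V)
    (hQ : (QuadraticMap.associated (R := k) Q).SeparatingLeft) {m : ℕ}
    (hV : Module.finrank k V = 2 * m + 1) :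
    ∃ u : k, u ≠ 0 ∧ ∀ c : k, (#{x : V | Q x = c} : ℤ) =
        (Fintype.card k : ℤ) ^ (2 * m) + quadraticChar k (u * c) * (Fintype.card k : ℤ) ^ m := by
  obtain ⟨w, ⟨e⟩⟩ := QuadraticForm.equivalent_weightedSumSquares_units_of_nondegenerate' Q hQ
  revert w
  rw [hV]
  intro w e
  obtain ⟨u, hu, h⟩ := card_sum_mul_sq_eq hk m w
  refine ⟨u, hu, fun c => ?_⟩
  rw [← h c]
  congr 1
  refine Finset.card_bij (fun x _ => e x) ?_ (fun x _ y _ hxy => e.injective hxy) ?_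
  · intro x hx
    simp only [mem_filter, mem_univ, true_and] at hx ⊢
    rw [← hx, ← e.map_app, QuadraticMap.weightedSumSquares_apply]
    rfl
  · intro y hy
    refine ⟨e.symm y, ?_, e.apply_symm_apply y⟩
    simp only [mem_filter, mem_univ, true_and] at hy ⊢
    rw [← hy, e.symm.map_app, QuadraticMap.weightedSumSquares_apply]
    rfl
end count

section traceForm
variable (k : Type*) {F : Type*} [Field k] [Fintype k] [Field F] [Algebra k F]

/-- The quadratic form `x ↦ Tr (x ^ (q ^ r + 1))` over the field `k` with `q` elements. -/
noncomputable def traceFrobeniusForm (F : Type*) [Field F] [Algebra k F] (r : ℕ) :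
    QuadraticForm k F :=
  LinearMap.BilinMap.toQuadraticMap
    ((Algebra.traceForm k F).comp ((FiniteField.frobeniusAlgHom k F) ^ r).toLinearMap LinearMap.id)

theorem frobeniusAlgHom_pow_apply (r : ℕ) (x : F) :
    ((FiniteField.frobeniusAlgHom k F) ^ r) x = x ^ Fintype.card k ^ r := by
  rw [AlgHom.coe_pow, FiniteField.coe_frobeniusAlgHom, pow_iterate]

theorem traceFrobeniusForm_apply (r : ℕ) (x : F) :
    traceFrobeniusForm k F r x = Algebra.trace k F (x ^ (Fintype.card k ^ r + 1)) := by
  simp [traceFrobeniusForm, Algebra.traceForm_apply, pow_succ, -AlgHom.coe_pow, frobeniusAlgHom_pow_apply]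

variable [Fintype F]

theorem trace_pow_card_pow (r : ℕ) (x : F) :
    Algebra.trace k F (x ^ Fintype.card k ^ r) = Algebra.trace k F x := by
  have h := Algebra.trace_eq_of_algEquiv (FiniteField.frobeniusAlgEquivOfAlgebraic k F ^ r) x
  rwa [AlgEquiv.coe_pow, FiniteField.coe_frobeniusAlgEquivOfAlgebraic_iterate] at h

theorem polar_traceFrobeniusForm {m : ℕ} (hF : Module.finrank k F = 2 * m + 1) (x y : F) :
    QuadraticMap.polar (traceFrobeniusForm k F (m + 1)) x y = Algebra.trace k F
      ((x ^ Fintype.card k ^ (m + 1) + x ^ Fintype.card k ^ m) * y) := by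
  have h1 : Algebra.trace k F (x * y ^ Fintype.card k ^ (m + 1)) =
      Algebra.trace k F (x ^ Fintype.card k ^ m * y) := by
    rw [← trace_pow_card_pow k m, mul_pow, ← pow_mul y, ← pow_add,
      show m + 1 + m = 2 * m + 1 by ring, ← hF, ← Module.card_eq_pow_finrank, FiniteField.pow_card]
  rw [add_mul, map_add, ← h1, traceFrobeniusForm, LinearMap.BilinMap.polar_toQuadraticMap]
  simp [Algebra.traceForm_apply, -AlgHom.coe_pow, frobeniusAlgHom_pow_apply, mul_comm]

theorem bijective_pow_add_pow (hk : ringChar k ≠ 2) {m : ℕ}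
    (hF : Module.finrank k F = 2 * m + 1) :
    Function.Bijective fun x : F => x ^ Fintype.card k ^ (m + 1) + x ^ Fintype.card k ^ m := by
  have hlin : ∀ x : F, (((FiniteField.frobeniusAlgHom k F) ^ (m + 1)).toLinearMap +
      ((FiniteField.frobeniusAlgHom k F) ^ m).toLinearMap) x =
      x ^ Fintype.card k ^ (m + 1) + x ^ Fintype.card k ^ m := fun x => by
    simp [-AlgHom.coe_pow, frobeniusAlgHom_pow_apply]
  have hodd : Odd (Fintype.card k) := Nat.odd_iff.2 (FiniteField.odd_card_of_char_ne_two hk)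
  have h2 : (2 : F) ≠ 0 := by
    rw [← map_ofNat (algebraMap k F) 2]
    exact (map_ne_zero _).2 (Ring.two_ne_zero hk)
  rw [← Finite.injective_iff_bijective]
  simp only [← hlin]
  rw [← LinearMap.ker_eq_bot, LinearMap.ker_eq_bot']
  intro x hx
  rw [hlin] at hx
  have h3 : (x ^ Fintype.card k + x) ^ Fintype.card k ^ m = 0 := by
    rw [← frobeniusAlgHom_pow_apply, map_add, frobeniusAlgHom_pow_apply, frobeniusAlgHom_pow_apply,
      ← pow_mul, mul_comm (Fintype.card k), ← pow_succ]
    exact hx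
  have h4 : x ^ Fintype.card k = -x := eq_neg_of_add_eq_zero_left (eq_zero_of_pow_eq_zero h3)
  have h5 : ∀ i : ℕ, x ^ Fintype.card k ^ i = (-1) ^ i * x := fun i => by
    induction i with
    | zero => simp
    | succ i ih => rw [pow_succ, pow_mul, ih, mul_pow, h4, ← pow_mul, mul_comm i, pow_mul,
        hodd.neg_one_pow]; ring
  have h6 := h5 (2 * m + 1)
  rw [← hF, ← Module.card_eq_pow_finrank, FiniteField.pow_card, hF, pow_succ, pow_mul] at h6
  have h7 : (2 : F) * x = 0 := by
    have : x = -x := by simpa using h6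
    linear_combination this
  exact (mul_eq_zero.1 h7).resolve_left h2

theorem card_traceFrobeniusForm [DecidableEq k] (hk : ringChar k ≠ 2) {m : ℕ}
    (hF : Module.finrank k F = 2 * m + 1) :
    ∃ u : k, u ≠ 0 ∧ ∀ c : k, (#{x : F | Algebra.trace k F (x ^ (Fintype.card k ^ (m + 1) + 1)) = c} : ℤ) =
        (Fintype.card k : ℤ) ^ (2 * m) + quadraticChar k (u * c) * (Fintype.card k : ℤ) ^ m := by
  let : Invertible (2 : k) := invertibleOfNonzero (Ring.two_ne_zero hk)
  have h := QuadraticForm.card_eq_of_odd_finrank hk (traceFrobeniusForm k F (m + 1)) ?_ hF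
  · simpa only [traceFrobeniusForm_apply] using h
  · intro x hx
    have h1 : ∀ y, Algebra.trace k F
        ((x ^ Fintype.card k ^ (m + 1) + x ^ Fintype.card k ^ m) * y) = 0 := fun y => by
      have h := LinearMap.congr_fun₂
        (QuadraticMap.two_nsmul_associated k (Q := traceFrobeniusForm k F (m + 1))) x y
      rw [LinearMap.smul_apply, LinearMap.smul_apply, hx y, smul_zero] at h
      rw [← polar_traceFrobeniusForm k hF]
      exact h.symm
    have h2 := (traceForm_nondegenerate k F).1 _ h1
    refine (bijective_pow_add_pow k hk hF).1 ?_
    simpa using h2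

/-- The number of affine points of the curve on a non-vertical line, after completing the square. -/
theorem card_trace_eq_trace_linear [DecidableEq k] {m : ℕ}
    (hF : Module.finrank k F = 2 * m + 1) (x₀ b : F) :
    #{x : F | Algebra.trace k F
        ((x₀ ^ Fintype.card k ^ (m + 1) + x₀ ^ Fintype.card k ^ m) * x + b) =
        Algebra.trace k F (x ^ (Fintype.card k ^ (m + 1) + 1))} =
      #{x : F | Algebra.trace k F (x ^ (Fintype.card k ^ (m + 1) + 1)) =
        Algebra.trace k F (x₀ ^ (Fintype.card k ^ (m + 1) + 1) + b)} := by
  have hp : ∀ x, traceFrobeniusForm k F (m + 1) (x₀ + x) =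
      traceFrobeniusForm k F (m + 1) x₀ + traceFrobeniusForm k F (m + 1) x +
      Algebra.trace k F ((x₀ ^ Fintype.card k ^ (m + 1) + x₀ ^ Fintype.card k ^ m) * x) := fun x => by
    rw [← polar_traceFrobeniusForm k hF, QuadraticMap.polar]; ring
  have hs := map_add (Algebra.trace k F)
  simp only [← traceFrobeniusForm_apply, hs] at hp ⊢
  refine Finset.card_bij (fun x _ => x₀ + -x) ?_ (fun x _ y _ h => by simpa using h) ?_
  · intro x hx
    simp only [mem_filter, mem_univ, true_and] at hx ⊢
    have h := hp (-x)
    rw [QuadraticMap.map_neg, mul_neg, map_neg] at h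
    rw [h, ← hx]
    ring
  · intro y hy
    simp only [mem_filter, mem_univ, true_and] at hy ⊢
    refine ⟨x₀ + -y, ?_, by ring⟩
    have h := hp (-(x₀ + -y))
    rw [show x₀ + -(x₀ + -y) = y by ring, QuadraticMap.map_neg, mul_neg, map_neg, hy] at h
    linear_combination h

theorem card_trace_eq [DecidableEq k] {m : ℕ} (hF : Module.finrank k F = 2 * m + 1) (c : k) :
    #{y : F | Algebra.trace k F y = c} = Fintype.card k ^ (2 * m) := by
  have h1 : ∀ c, #{y : F | Algebra.trace k F y = c} = #{y : F | Algebra.trace k F y = 0} := fun c => by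
    obtain ⟨z, hz⟩ := Algebra.trace_surjective k F c
    refine Finset.card_bij (fun y _ => y - z) ?_ (fun x _ y _ h => by simpa using h) ?_
    · intro y hy
      simp only [mem_filter, mem_univ, true_and] at hy ⊢
      rw [map_sub, hy, hz, sub_self]
    · intro y hy
      simp only [mem_filter, mem_univ, true_and] at hy ⊢
      exact ⟨y + z, by rw [map_add, hy, hz, zero_add], by ring⟩
  have h2 := Finset.card_eq_sum_card_fiberwise (s := (univ : Finset F)) (t := (univ : Finset k))
    (f := Algebra.trace k F) (fun _ _ => by simp)
  simp only [h1] at h2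
  rw [Finset.sum_const, card_univ, card_univ, smul_eq_mul, Module.card_eq_pow_finrank (K := k), hF,
    pow_succ'] at h2
  rw [h1]
  exact (Nat.eq_of_mul_eq_mul_left Fintype.card_pos h2).symm
end traceForm

section plane
variable {F : Type*} [Field F]

/-- The point `(x : y : 1)` of the projective plane. -/
def affinePoint (p : F × F) : Projectivization F (Fin 3 → F) :=
  Projectivization.mk F ![p.1, p.2, 1] fun h => one_ne_zero (congrFun h 2)

/-- The point `(0 : 1 : 0)` of the projective plane. -/
def verticalPoint (F : Type*) [Field F] : Projectivization F (Fin 3 → F) :=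
  Projectivization.mk F ![0, 1, 0] fun h => one_ne_zero (congrFun h 1)

/-- The line `α X + β Y + γ Z = 0` of the projective plane. -/
def projLine (α β γ : F) : Set (Projectivization F (Fin 3 → F)) :=
  {P | α * P.rep 0 + β * P.rep 1 + γ * P.rep 2 = 0}

theorem mk_mem_projLine {v : Fin 3 → F} (hv : v ≠ 0) {α β γ : F} :
    Projectivization.mk F v hv ∈ projLine α β γ ↔ α * v 0 + β * v 1 + γ * v 2 = 0 := by
  obtain ⟨a, ha⟩ := Projectivization.exists_smul_eq_mk_rep F v hv
  have h : α * (a • v) 0 + β * (a • v) 1 + γ * (a • v) 2 =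
      a * (α * v 0 + β * v 1 + γ * v 2) := by
    simp only [Pi.smul_apply, Units.smul_def, smul_eq_mul]; ring
  rw [projLine, Set.mem_ofPred_eq, ← ha, h, mul_eq_zero, or_iff_right a.ne_zero]

theorem affinePoint_mem_projLine {p : F × F} {α β γ : F} :
    affinePoint p ∈ projLine α β γ ↔ α * p.1 + β * p.2 + γ = 0 := by
  rw [affinePoint, mk_mem_projLine]; simp

theorem verticalPoint_mem_projLine {α β γ : F} :
    verticalPoint F ∈ projLine α β γ ↔ β = 0 := by
  rw [verticalPoint, mk_mem_projLine]; simp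

theorem affinePoint_injective : Function.Injective (affinePoint (F := F)) := by
  intro p s h
  obtain ⟨a, ha⟩ := (Projectivization.mk_eq_mk_iff' F _ _ _ _).1 h
  have h2 := congrFun ha 2
  have h0 := congrFun ha 0
  have h1 := congrFun ha 1
  simp at h0 h1 h2
  subst h2
  ext <;> simp_all

theorem affinePoint_ne_verticalPoint (p : F × F) : affinePoint p ≠ verticalPoint F := by
  intro h
  obtain ⟨a, ha⟩ := (Projectivization.mk_eq_mk_iff' F _ _ _ _).1 h
  simpa using congrFun ha 2

theorem eq_affinePoint_or_mk_or_verticalPoint (P : Projectivization F (Fin 3 → F)) :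
    (∃ p, P = affinePoint p) ∨
    (∃ s : F, ∀ β γ : F, P ∈ projLine (-β * s) β γ) ∨ P = verticalPoint F := by
  induction P with
  | h v hv =>
    by_cases h2 : v 2 = 0
    · right
      by_cases h0 : v 0 = 0
      · right
        refine (Projectivization.mk_eq_mk_iff' F _ _ _ _).2 ⟨v 1, ?_⟩
        ext i; fin_cases i <;> simp [h0, h2]
      · left
        refine ⟨v 1 / v 0, fun β γ => ?_⟩
        rw [mk_mem_projLine, h2]
        field_simp
        ring
    · left
      refine ⟨(v 0 / v 2, v 1 / v 2), ?_⟩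
      refine (Projectivization.mk_eq_mk_iff' F _ _ _ _).2 ⟨v 2, ?_⟩
      ext i; fin_cases i <;> simp <;> field_simp

variable [Fintype F]

theorem natCard_affinePoint_union (S : F × F → Prop) [DecidablePred S] :
    Nat.card ↥(affinePoint '' {p | S p} ∪ {verticalPoint F}) = #{p : F × F | S p} + 1 := by
  rw [Nat.card_coe_set_eq, Set.union_singleton, Set.ncard_insert_of_notMem,
    Set.ncard_image_of_injective _ affinePoint_injective, Set.ncard_eq_toFinset_card']
  · congr 2; ext; simp
  · rintro ⟨p, -, h⟩
    exact affinePoint_ne_verticalPoint p h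

theorem natCard_inter_projLine_of_ne_zero (S : F × F → Prop) [DecidablePred S] {α β γ : F}
    (hβ : β ≠ 0) :
    Nat.card ↥((affinePoint '' {p | S p} ∪ {verticalPoint F}) ∩ projLine α β γ) =
      #{x : F | S (x, -α / β * x + -γ / β)} := by
  have h : (affinePoint '' {p | S p} ∪ {verticalPoint F}) ∩ projLine α β γ =
      (fun x => affinePoint (x, -α / β * x + -γ / β)) ''
        {x : F | S (x, -α / β * x + -γ / β)} := by
    ext P
    constructor
    · rintro ⟨⟨⟨x, y⟩, hp, rfl⟩ | rfl, hL⟩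
      · rw [affinePoint_mem_projLine] at hL
        have : y = -α / β * x + -γ / β := by
          field_simp; linear_combination hL
        subst this
        exact ⟨x, hp, rfl⟩
      · exact absurd (verticalPoint_mem_projLine.1 hL) hβ
    · rintro ⟨x, hx, rfl⟩
      refine ⟨Or.inl ⟨_, hx, rfl⟩, ?_⟩
      dsimp only
      rw [affinePoint_mem_projLine]
      field_simp; ring
  rw [h, Nat.card_coe_set_eq, Set.ncard_image_of_injective, Set.ncard_eq_toFinset_card']
  · congr 1; ext; simp
  · intro x y h
    exact congrArg Prod.fst (affinePoint_injective h)

theorem natCard_inter_projLine_vertical_le (S : F × F → Prop) [DecidablePred S] {α γ : F}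
    (h : (α, γ) ≠ (0, 0)) :
    Nat.card ↥((affinePoint '' {p | S p} ∪ {verticalPoint F}) ∩ projLine α 0 γ) ≤
      #{y : F | S (-γ / α, y)} + 1 := by
  have h : (affinePoint '' {p | S p} ∪ {verticalPoint F}) ∩ projLine α 0 γ ⊆
      insert (verticalPoint F) ((fun y => affinePoint (-γ / α, y)) '' {y : F | S (-γ / α, y)}) := by
    rintro P ⟨⟨⟨x, y⟩, hp, rfl⟩ | rfl, hL⟩
    · rw [affinePoint_mem_projLine] at hL
      right
      have hα : α ≠ 0 := by
        rintro rfl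
        simp at hL
        simp [hL] at h
      have : x = -γ / α := by
        field_simp; linear_combination hL
      subst this
      exact ⟨y, hp, rfl⟩
    · exact Set.mem_insert _ _
  rw [Nat.card_coe_set_eq]
  refine (Set.ncard_le_ncard h (Set.toFinite _)).trans ((Set.ncard_insert_le _ _).trans ?_)
  refine Nat.add_le_add_right ((Set.ncard_image_le (Set.toFinite _)).trans ?_) 1
  rw [Set.ncard_eq_toFinset_card']
  refine le_of_eq ?_
  congr 1; ext; simp
end plane

section arc
variable {k F : Type*} [Field k] [Fintype k] [DecidableEq k] [Field F] [Fintype F]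
  [Algebra k F] {m : ℕ}

variable (k m) in
/-- The pointset of the generalized Hermitian curve, over the subfield `k` with `q` elements. -/
def generalizedHermitianPoints (F : Type*) [Field F] [Algebra k F] :
    Set (Projectivization F (Fin 3 → F)) :=
  affinePoint '' {p | Algebra.trace k F p.2 = Algebra.trace k F (p.1 ^ (Fintype.card k ^ (m + 1) + 1))} ∪
    {verticalPoint F}

theorem natCard_generalizedHermitianPoints (hF : Module.finrank k F = 2 * m + 1) :
    Nat.card (generalizedHermitianPoints k m F) = Fintype.card k ^ (4 * m + 1) + 1 := by
  rw [generalizedHermitianPoints, natCard_affinePoint_union]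
  congr 1
  rw [Finset.card_filter, Fintype.sum_prod_type]
  simp only [← Finset.card_filter, card_trace_eq k hF]
  rw [Finset.sum_const, card_univ, Module.card_eq_pow_finrank (K := k), hF, smul_eq_mul, ← pow_add]
  congr 1; ring

theorem exists_card_trace_eq_trace_linear (hk : ringChar k ≠ 2)
    (hF : Module.finrank k F = 2 * m + 1) :
    ∃ u : k, u ≠ 0 ∧ ∀ x₀ b : F, (#{x : F | Algebra.trace k F
        ((x₀ ^ Fintype.card k ^ (m + 1) + x₀ ^ Fintype.card k ^ m) * x + b) =
        Algebra.trace k F (x ^ (Fintype.card k ^ (m + 1) + 1))} : ℤ) =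
        (Fintype.card k : ℤ) ^ (2 * m) + quadraticChar k (u *
          Algebra.trace k F (x₀ ^ (Fintype.card k ^ (m + 1) + 1) + b)) * (Fintype.card k : ℤ) ^ m := by
  obtain ⟨u, hu, h⟩ := card_traceFrobeniusForm k (F := F) hk hF
  refine ⟨u, hu, fun x₀ b => ?_⟩
  rw [card_trace_eq_trace_linear k hF, h]

theorem natCard_generalizedHermitianPoints_inter_projLine_le (hk : ringChar k ≠ 2)
    (hF : Module.finrank k F = 2 * m + 1) {α β γ : F} (h : (α, β, γ) ≠ (0, 0, 0)) :
    Nat.card ↥(generalizedHermitianPoints k m F ∩ projLine α β γ) ≤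
      Fintype.card k ^ (2 * m) + Fintype.card k ^ m := by
  rw [generalizedHermitianPoints]
  by_cases hβ : β = 0
  · subst hβ
    refine (natCard_inter_projLine_vertical_le _ (by simpa using h)).trans ?_
    simp only [card_trace_eq k hF]
    exact Nat.add_le_add_left (Nat.one_le_pow _ _ Fintype.card_pos) _
  · rw [natCard_inter_projLine_of_ne_zero _ hβ]
    obtain ⟨x₀, hx₀⟩ := (bijective_pow_add_pow k hk hF).2 (-α / β)
    obtain ⟨u, -, hu⟩ := exists_card_trace_eq_trace_linear (k := k) (F := F) hk hF
    have h1 := hu x₀ (-γ / β)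
    dsimp only at hx₀ ⊢
    rw [hx₀] at h1
    have h2 : quadraticChar k (u * Algebra.trace k F (x₀ ^ (Fintype.card k ^ (m + 1) + 1) + -γ / β))
        ≤ 1 := by
      rcases quadraticChar_isQuadratic k (u * Algebra.trace k F
        (x₀ ^ (Fintype.card k ^ (m + 1) + 1) + -γ / β)) with h | h | h <;> rw [h] <;> norm_num
    have h3 : (0 : ℤ) ≤ (Fintype.card k : ℤ) ^ m := by positivity
    zify
    rw [h1]
    nlinarith

theorem surjective_traceFrobeniusForm (hk : ringChar k ≠ 2) (hm : 1 ≤ m)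
    (hF : Module.finrank k F = 2 * m + 1) :
    Function.Surjective (traceFrobeniusForm k F (m + 1)) := by
  intro c
  obtain ⟨u, -, h⟩ := card_traceFrobeniusForm k (F := F) hk hF
  have h1 := h c
  have h2 : (-1 : ℤ) ≤ quadraticChar k (u * c) := by
    rcases quadraticChar_isQuadratic k (u * c) with h | h | h <;> rw [h] <;> norm_num
  have h3 : (Fintype.card k : ℤ) ^ m < (Fintype.card k : ℤ) ^ (2 * m) :=
    pow_lt_pow_right₀ (by exact_mod_cast Fintype.one_lt_card) (by lia)
  have h4 : (0 : ℤ) ≤ (Fintype.card k : ℤ) ^ m := by positivity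
  have h5 : 0 < #{x : F | Algebra.trace k F (x ^ (Fintype.card k ^ (m + 1) + 1)) = c} := by
    zify
    rw [h1]
    nlinarith
  obtain ⟨x, hx⟩ := Finset.card_pos.1 h5
  exact ⟨x, by simpa [traceFrobeniusForm_apply] using hx⟩

theorem exists_projLine_natCard_eq (hk : ringChar k ≠ 2) (hm : 1 ≤ m)
    (hF : Module.finrank k F = 2 * m + 1) {P : Projectivization F (Fin 3 → F)}
    (hP : P ∉ generalizedHermitianPoints k m F) :
    ∃ α β γ : F, (α, β, γ) ≠ (0, 0, 0) ∧ P ∈ projLine α β γ ∧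
      Nat.card ↥(generalizedHermitianPoints k m F ∩ projLine α β γ) =
        Fintype.card k ^ (2 * m) + Fintype.card k ^ m := by
  obtain ⟨u, hu0, hu⟩ := exists_card_trace_eq_trace_linear (k := k) (F := F) hk hF
  suffices H : ∃ x₀ b : F,
      P ∈ projLine (x₀ ^ Fintype.card k ^ (m + 1) + x₀ ^ Fintype.card k ^ m) (-1) b ∧
      Algebra.trace k F (x₀ ^ (Fintype.card k ^ (m + 1) + 1) + b) = u⁻¹ by
    obtain ⟨x₀, b, hPL, htr⟩ := H
    refine ⟨_, -1, b, by simp, hPL, ?_⟩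
    rw [generalizedHermitianPoints, natCard_inter_projLine_of_ne_zero _ (by simp)]
    have h1 := hu x₀ b
    rw [htr, mul_inv_cancel₀ hu0, map_one, one_mul] at h1
    simp only [neg_div_neg_eq, div_one]
    exact_mod_cast h1
  rcases eq_affinePoint_or_mk_or_verticalPoint P with ⟨⟨a, b⟩, rfl⟩ | ⟨s, hs⟩ | rfl
  · obtain ⟨w, hw⟩ := surjective_traceFrobeniusForm hk hm hF
      (u⁻¹ + traceFrobeniusForm k F (m + 1) a - Algebra.trace k F b)
    have hp := polar_traceFrobeniusForm k hF (a + w) (-a)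
    rw [QuadraticMap.polar, add_neg_cancel_comm, hw, QuadraticMap.map_neg, mul_neg, map_neg] at hp
    refine ⟨a + w, b - ((a + w) ^ Fintype.card k ^ (m + 1) + (a + w) ^ Fintype.card k ^ m) * a,
      affinePoint_mem_projLine.2 (by ring), ?_⟩
    rw [map_add, map_sub, ← traceFrobeniusForm_apply]
    linear_combination -hp
  · obtain ⟨x₀, hx₀⟩ := (bijective_pow_add_pow k hk hF).2 s
    obtain ⟨b, hb⟩ := Algebra.trace_surjective k F
      (u⁻¹ - Algebra.trace k F (x₀ ^ (Fintype.card k ^ (m + 1) + 1)))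
    refine ⟨x₀, b, ?_, by rw [map_add, hb]; ring⟩
    dsimp only at hx₀
    rw [hx₀]
    simpa using hs (-1) b
  · exact absurd (Or.inr rfl) hP
end arc

theorem exists_subfield_algebra {p n ℓ : ℕ} (hp : p.Prime) (hn : 1 ≤ n)
    (F : Type) [Field F] [Fintype F] (hF : Fintype.card F = (p ^ n) ^ ℓ) :
    ∃ (k : Type) (_ : Field k) (_ : Fintype k) (_ : Algebra k F),
      Fintype.card k = p ^ n ∧ Module.finrank k F = ℓ ∧ ringChar k = p := by
  have : Fact p.Prime := ⟨hp⟩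
  have hn0 : n ≠ 0 := by lia
  have : CharP F p := charP_of_card_eq_prime_pow (f := n * ℓ) (by rw [hF, pow_mul])
  let : Algebra (ZMod p) F := ZMod.algebra F p
  let : Fintype (GaloisField p n) := Fintype.ofFinite _
  have hk : Fintype.card (GaloisField p n) = p ^ n := by
    rw [← Nat.card_eq_fintype_card, GaloisField.card p n hn0]
  have h1 : Module.finrank (ZMod p) F = n * ℓ := by
    refine Nat.pow_right_injective hp.two_le ?_
    dsimp only
    rw [FiniteField.pow_finrank_eq_card, hF, pow_mul]
  obtain ⟨f⟩ := FiniteField.nonempty_algHom_of_finrank_dvd (F := ZMod p) (K := GaloisField p n)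
    (L := F) (by rw [GaloisField.finrank p hn0, h1]; exact dvd_mul_right _ _)
  let : Algebra (GaloisField p n) F := f.toRingHom.toAlgebra
  refine ⟨GaloisField p n, inferInstance, inferInstance, inferInstance, hk, ?_, ringChar.eq _ p⟩
  refine Nat.pow_right_injective (Nat.one_lt_pow hn0 hp.one_lt) ?_
  dsimp only
  rw [← hF, Module.card_eq_pow_finrank (K := GaloisField p n) (V := F), hk]

/-- Let `p > 2` be prime, `q = p ^ n`, `ℓ ≥ 3` odd, `r = (ℓ+1)/2`.  The
pointset `K = {(x : y : 1) : T y = T (x^(q^r+1))} ∪ {(0 : 1 : 0)}` is a complete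
`(N, d)`-arc in `PG(2, q^ℓ)` with `N = q^(2ℓ-1) + 1` and `d = q^(ℓ-1) + q^(r-1)`:
`#K = N`, every line meets `K` in at most `d` points, and through every point `P ∉ K`
there is a line meeting `K` in exactly `d` points. -/
theorem stmt_14 (p n : ℕ) (hp : p.Prime) (hp2 : 2 < p) (hn : 1 ≤ n)
    (q : ℕ) (hq : q = p ^ n)
    (ℓ r : ℕ) (hℓ : 3 ≤ ℓ) (hlo : Odd ℓ) (hr : r = (ℓ + 1) / 2)
    (F : Type) [Field F] [Fintype F] (hF : Fintype.card F = q ^ ℓ)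
    (T : F → F) (hT : ∀ z : F, T z = ∑ i ∈ Finset.range ℓ, z ^ q ^ i)
    (K : Set (Projectivization F (Fin 3 → F)))
    (hK : K = {P | ∃ x y : F, T y = T (x ^ (q ^ r + 1)) ∧
          P = Projectivization.mk F ![x, y, 1]
            (fun h => one_ne_zero (congrFun h 2))} ∪
        {Projectivization.mk F ![0, 1, 0]
            (fun h => one_ne_zero (congrFun h 1))}) :
    Nat.card ↥K = q ^ (2 * ℓ - 1) + 1 ∧
    (∀ α β γ : F, (α, β, γ) ≠ (0, 0, 0) →
      Nat.card ↥(K ∩ {P : Projectivization F (Fin 3 → F) |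
          α * P.rep 0 + β * P.rep 1 + γ * P.rep 2 = 0})
        ≤ q ^ (ℓ - 1) + q ^ (r - 1)) ∧
    (∀ P : Projectivization F (Fin 3 → F), P ∉ K → ∃ α β γ : F,
      (α, β, γ) ≠ (0, 0, 0) ∧ α * P.rep 0 + β * P.rep 1 + γ * P.rep 2 = 0 ∧
      Nat.card ↥(K ∩ {Q : Projectivization F (Fin 3 → F) |
          α * Q.rep 0 + β * Q.rep 1 + γ * Q.rep 2 = 0})
        = q ^ (ℓ - 1) + q ^ (r - 1)) := by
  subst hq
  obtain ⟨k, _, _, _, hk, hfr, hchar⟩ := exists_subfield_algebra hp hn F hF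
  obtain ⟨m, rfl⟩ := hlo
  obtain rfl : r = m + 1 := by lia
  classical
  have hTt : ∀ y z, T y = T z ↔ Algebra.trace k F y = Algebra.trace k F z := fun y z => by
    have h : ∀ z, T z = algebraMap k F (Algebra.trace k F z) := fun z => by
      rw [hT, FiniteField.algebraMap_trace_eq_sum_pow, hfr, Nat.card_eq_fintype_card, hk]
    rw [h, h, (algebraMap k F).injective.eq_iff]
  have hK' : K = generalizedHermitianPoints k m F := by
    rw [hK, generalizedHermitianPoints, hk]
    congr 1
    ext P
    constructor
    · rintro ⟨x, y, h, rfl⟩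
      exact ⟨(x, y), (hTt _ _).1 h, rfl⟩
    · rintro ⟨⟨x, y⟩, h, rfl⟩
      exact ⟨x, y, (hTt _ _).2 h, rfl⟩
  have hchar2 : ringChar k ≠ 2 := by lia
  subst hK'
  rw [← hk, show 2 * (2 * m + 1) - 1 = 4 * m + 1 by lia, Nat.add_sub_cancel, Nat.add_sub_cancel]
  refine ⟨natCard_generalizedHermitianPoints hfr, fun α β γ h =>
    natCard_generalizedHermitianPoints_inter_projLine_le hchar2 hfr h, fun P hP =>
    exists_projLine_natCard_eq hchar2 (by lia) hfr hP⟩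
end
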